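/- There exists ε₀ > 0 such that for every ε ∈ (0, ε₀) and every constant α ∈ (0, ε⁸) the following holds. For every γ > 0 there exist β > 0 and n₀ ∈ ℕ such that for all n ≥ n₀, all d with 1 + ε ≤ d ≤ β·n, and every (n,d,λ)-graph G with λ/d ≤ α^{2/α}: setting p = (1+ε)/d, with probability at least 1 − γ the number of edges of the p-site-percolated subgraph G_p lying in connected components that are neither a largest component of G_p nor trees is at most 7·α^{1/4}·n/d. -/

import Mathlib

open Finset

/-- The adjacency matrix of `G` over `ℝ` is Hermitian. -/
noncomputable def SimpleGraph.adjHermitian {n : ℕ} (G : SimpleGraph (Fin n)) :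
    letI := Classical.decRel G.Adj
    ((G.adjMatrix ℝ).IsHermitian) := by
  letI := Classical.decRel G.Adj
  rw [Matrix.IsHermitian, Matrix.conjTranspose_eq_transpose_of_trivial]
  exact G.isSymm_adjMatrix

/-- `G` is an `(n,d,λ)`-graph: a `d`-regular graph on `n` vertices all of whose
adjacency-matrix eigenvalues, except one eigenvalue equal to `d`, have absolute
value at most `lam`. -/
noncomputable def IsNDLGraph (n d : ℕ) (lam : ℝ) (G : SimpleGraph (Fin n)) : Prop :=
  letI := Classical.decRel G.Adj
  G.IsRegularOfDegree d ∧
    ∃ i₀ : Fin n, (G.adjHermitian.eigenvalues i₀ = d ∧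
      ∀ i : Fin n, i ≠ i₀ → |G.adjHermitian.eigenvalues i| ≤ lam)

/-- `G` has an induced path on `k` vertices. -/
def HasInducedPath {V : Type*} (G : SimpleGraph V) (k : ℕ) : Prop :=
  ∃ f : Fin k → V, Function.Injective f ∧
    ∀ i j : Fin k, G.Adj (f i) (f j) ↔ ((i : ℕ) + 1 = (j : ℕ) ∨ (j : ℕ) + 1 = (i : ℕ))

/-- `G` has an induced cycle of length `k`. -/
def HasInducedCycle {V : Type*} (G : SimpleGraph V) (k : ℕ) : Prop :=
  3 ≤ k ∧ ∃ f : ZMod k → V, Function.Injective f ∧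
    ∀ i j : ZMod k, G.Adj (f i) (f j) ↔ (i - j = 1 ∨ j - i = 1)

open MeasureTheory in
/-- The Bernoulli measure on `Bool` with success probability `p`. -/
noncomputable def bernoulliMeasure (p : ℝ) : Measure Bool :=
  (ENNReal.ofReal p) • Measure.dirac true + (ENNReal.ofReal (1 - p)) • Measure.dirac false

open MeasureTheory in
/-- The site-percolation measure on subsets of `V` (encoded as functions `V → Bool`):
every vertex is retained independently with probability `p`. -/
noncomputable def percolationMeasure (V : Type*) [Fintype V] (p : ℝ) :
    Measure (V → Bool) :=
  Measure.pi fun _ : V => bernoulliMeasure p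

/-- The vertex set retained by the percolation outcome `ω`. -/
def percSet {V : Type*} (ω : V → Bool) : Set V := {v : V | ω v = true}

namespace SitePercolation

/-- The real-valued indicator of a proposition. -/
noncomputable def ind (q : Prop) : ℝ := open Classical in if q then 1 else 0

lemma ind_true {q : Prop} (h : q) : ind q = 1 := by simp [ind, h]

lemma ind_false {q : Prop} (h : ¬ q) : ind q = 0 := by simp [ind, h]

lemma ind_nonneg (q : Prop) : 0 ≤ ind q := by
  unfold ind; split_ifs <;> norm_num

lemma ind_le {q : Prop} {x : ℝ} (hx : 0 ≤ x) (h : q → 1 ≤ x) : ind q ≤ x := by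
  by_cases hq : q
  · rw [ind_true hq]; exact h hq
  · rw [ind_false hq]; exact hx

section Expectation

variable {V : Type*} [Fintype V] [DecidableEq V]

/-- The expectation of `f P`, where `P` contains each vertex independently with probability `p`. -/
noncomputable def expect (p : ℝ) (f : Finset V → ℝ) : ℝ :=
  ∑ P : Finset V, p ^ #P * (1 - p) ^ #Pᶜ * f P

/-- The probability that the random set `P` satisfies `E`. -/
noncomputable def prob (p : ℝ) (E : Finset V → Prop) : ℝ := expect p fun P => ind (E P)

lemma expect_mono {p : ℝ} (h0 : 0 ≤ p) (h1 : p ≤ 1) {f g : Finset V → ℝ} (h : ∀ P, f P ≤ g P) :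
    expect p f ≤ expect p g := by
  have : 0 ≤ 1 - p := by linarith
  exact sum_le_sum fun P _ => mul_le_mul_of_nonneg_left (h P) (by positivity)

lemma expect_sum {ι : Type*} (p : ℝ) (s : Finset ι) (f : ι → Finset V → ℝ) :
    expect p (fun P => ∑ i ∈ s, f i P) = ∑ i ∈ s, expect p (f i) := by
  simp only [expect, mul_sum]
  exact sum_comm

lemma expect_mul (p x : ℝ) (f : Finset V → ℝ) :
    expect p (fun P => x * f P) = x * expect p f := by
  simp only [expect, mul_sum]
  exact sum_congr rfl fun _ _ => by ring

lemma expect_add (p : ℝ) (f g : Finset V → ℝ) :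
    expect p (fun P => f P + g P) = expect p f + expect p g := by
  simp only [expect, mul_add, sum_add_distrib]

lemma expect_prod (p : ℝ) (a b : V → ℝ) :
    expect p (fun P => (∏ i ∈ P, a i) * ∏ i ∈ Pᶜ, b i) =
      ∏ i, (p * a i + (1 - p) * b i) := by
  rw [prod_add, powerset_univ, expect]
  refine sum_congr rfl fun P _ => ?_
  rw [prod_mul_distrib, prod_mul_distrib, prod_const, prod_const, ← compl_eq_univ_sdiff]
  ring

lemma ind_subset_mul_disjoint (H D P : Finset V) :
    ind (H ⊆ P ∧ Disjoint P D) =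
      (∏ i ∈ P, if i ∈ D then (0 : ℝ) else 1) * ∏ i ∈ Pᶜ, if i ∈ H then (0 : ℝ) else 1 := by
  by_cases h1 : H ⊆ P
  · by_cases h2 : Disjoint P D
    · rw [ind_true ⟨h1, h2⟩, prod_eq_one, prod_eq_one, one_mul]
      · intro i hi
        rw [if_neg]
        exact fun h => (mem_compl.1 hi) (h1 h)
      · intro i hi
        rw [if_neg]
        exact fun h => disjoint_left.1 h2 hi h
    · rw [ind_false fun h => h2 h.2]
      obtain ⟨i, hi, hi'⟩ := not_disjoint_iff.1 h2
      rw [prod_eq_zero hi (by simp [hi']), zero_mul]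
  · rw [ind_false fun h => h1 h.1]
    obtain ⟨i, hi, hi'⟩ := not_subset.1 h1
    rw [prod_eq_zero (i := i) (s := Pᶜ) (by simpa using hi') (by simp [hi]), mul_zero]

lemma prob_subset_disjoint (p : ℝ) {H D : Finset V} (hHD : Disjoint H D) :
    prob p (fun P => H ⊆ P ∧ Disjoint P D) = p ^ #H * (1 - p) ^ #D := by
  rw [prob]
  simp_rw [ind_subset_mul_disjoint]
  rw [expect_prod]
  have : ∀ i, p * (if i ∈ D then (0 : ℝ) else 1) + (1 - p) * (if i ∈ H then (0 : ℝ) else 1) =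
      (if i ∈ H then p else 1) * (if i ∈ D then 1 - p else 1) := by
    intro i
    by_cases h1 : i ∈ H
    · have := disjoint_left.1 hHD h1
      simp [h1, this]
    · by_cases h2 : i ∈ D <;> simp [h1, h2]
  simp_rw [this]
  rw [prod_mul_distrib, prod_ite_mem, prod_ite_mem]
  simp

lemma prob_subset (p : ℝ) (H : Finset V) : prob p (fun P => H ⊆ P) = p ^ #H := by
  have := prob_subset_disjoint p (disjoint_empty_right H)
  simpa using this

lemma expect_one (p : ℝ) : expect p (fun _ : Finset V => 1) = 1 := by
  have := prob_subset p (∅ : Finset V)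
  simpa [prob, ind_true] using this

lemma expect_subset_mul_pow (p x : ℝ) {H Q : Finset V} (hHQ : Disjoint H Q) :
    expect p (fun P => ind (H ⊆ P) * x ^ #(P ∩ Q)) = p ^ #H * (1 + p * (x - 1)) ^ #Q := by
  have h : ∀ P : Finset V, ind (H ⊆ P) * x ^ #(P ∩ Q) =
      (∏ i ∈ P, if i ∈ Q then x else 1) * ∏ i ∈ Pᶜ, if i ∈ H then (0 : ℝ) else 1 := by
    intro P
    have := ind_subset_mul_disjoint H ∅ P
    simp only [disjoint_empty_right, and_true, notMem_empty, if_false, prod_const_one,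
      one_mul] at this
    rw [this, prod_ite_mem P, prod_const, mul_comm]
  simp_rw [h]
  rw [expect_prod]
  have : ∀ i, p * (if i ∈ Q then x else 1) + (1 - p) * (if i ∈ H then (0 : ℝ) else 1) =
      (if i ∈ H then p else 1) * (if i ∈ Q then 1 + p * (x - 1) else 1) := by
    intro i
    by_cases h1 : i ∈ H
    · have := disjoint_left.1 hHQ h1
      simp [h1, this]
    · by_cases h2 : i ∈ Q
      · simp [h1, h2]; ring
      · simp [h1, h2]
  simp_rw [this]
  rw [prod_mul_distrib, prod_ite_mem, prod_ite_mem]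
  simp

lemma prob_mono {p : ℝ} (h0 : 0 ≤ p) (h1 : p ≤ 1) {E F : Finset V → Prop} (h : ∀ P, E P → F P) :
    prob p E ≤ prob p F :=
  expect_mono h0 h1 fun P => ind_le (ind_nonneg _) fun hE => (ind_true (h P hE)).ge

lemma prob_or_le {p : ℝ} (h0 : 0 ≤ p) (h1 : p ≤ 1) (E F : Finset V → Prop) :
    prob p (fun P => E P ∨ F P) ≤ prob p E + prob p F := by
  rw [prob, prob, prob, ← expect_add]
  refine expect_mono h0 h1 fun P => ind_le (add_nonneg (ind_nonneg _) (ind_nonneg _)) ?_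
  rintro (h | h)
  · rw [ind_true h]; linarith [ind_nonneg (F P)]
  · rw [ind_true h]; linarith [ind_nonneg (E P)]

lemma prob_exists_le {p : ℝ} (h0 : 0 ≤ p) (h1 : p ≤ 1) {ι : Type*} (s : Finset ι)
    (E : ι → Finset V → Prop) :
    prob p (fun P => ∃ i ∈ s, E i P) ≤ ∑ i ∈ s, prob p (E i) := by
  simp only [prob]
  rw [← expect_sum]
  refine expect_mono h0 h1 fun P => ind_le (sum_nonneg fun _ _ => ind_nonneg _) ?_
  rintro ⟨i, hi, h⟩
  rw [← ind_true h]
  exact single_le_sum (f := fun i => ind (E i P)) (fun _ _ => ind_nonneg _) hi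

lemma sum_prob_le_one {p : ℝ} (h0 : 0 ≤ p) (h1 : p ≤ 1) {ι : Type*} (s : Finset ι)
    (E : ι → Finset V → Prop)
    (hE : ∀ P, ∀ i ∈ s, ∀ j ∈ s, E i P → E j P → i = j) :
    ∑ i ∈ s, prob p (E i) ≤ 1 := by
  simp only [prob]
  rw [← expect_sum, ← expect_one (V := V) p]
  refine expect_mono h0 h1 fun P => ?_
  by_cases h : ∃ i ∈ s, E i P
  · obtain ⟨i, hi, h⟩ := h
    rw [sum_eq_single_of_mem i hi, ind_true h]
    intro j hj hji
    exact ind_false fun h' => hji (hE P j hj i hi h' h)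
  · push Not at h
    rw [sum_eq_zero fun i hi => ind_false (h i hi)]
    exact zero_le_one

omit [DecidableEq V] in
/-- The generating function of the sizes of all subsets. -/
lemma sum_pow_card (x : ℝ) : ∑ F : Finset V, x ^ #F = (1 + x) ^ Fintype.card V := by
  have := prod_one_add (univ : Finset V) (f := fun _ => x)
  simp only [prod_const, card_univ, powerset_univ] at this
  exact this.symm

lemma one_add_pow_le_exp {x : ℝ} (hx : 0 ≤ x) (k : ℕ) : (1 + x) ^ k ≤ Real.exp (k * x) := by
  rw [Real.exp_nat_mul]
  exact pow_le_pow_left₀ (by linarith) (by linarith [Real.add_one_le_exp x]) k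

end Expectation

section Spectral

open Matrix

variable {n : ℕ}

lemma trace_pow_eq_sum_eigenvalues_pow {A : Matrix (Fin n) (Fin n) ℝ} (hA : A.IsHermitian)
    (k : ℕ) : (A ^ k).trace = ∑ i, hA.eigenvalues i ^ k := by
  conv_lhs => rw [hA.spectral_theorem, ← map_pow, diagonal_pow, Unitary.conjStarAlgAut_apply,
    Matrix.trace_mul_cycle, Unitary.coe_star_mul_self, one_mul, trace_diagonal]
  rfl

lemma dotProduct_self_mulVec_le {A : Matrix (Fin n) (Fin n) ℝ} (hA : A.IsHermitian)
    {i₀ : Fin n} {lam : ℝ} (hlam : lam < hA.eigenvalues i₀)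
    (hle : ∀ i, i ≠ i₀ → |hA.eigenvalues i| ≤ lam) {u x : Fin n → ℝ} (hu : u ≠ 0)
    (hAu : A *ᵥ u = hA.eigenvalues i₀ • u) (hux : u ⬝ᵥ x = 0) :
    (A *ᵥ x) ⬝ᵥ (A *ᵥ x) ≤ lam ^ 2 * (x ⬝ᵥ x) := by
  set b := hA.eigenvectorBasis
  have hT : Aᵀ = A := by
    have := hA.eq
    rwa [conjTranspose_eq_transpose_of_trivial] at this
  have hparseval : ∀ y z : Fin n → ℝ,
      ∑ i, ((b i).ofLp ⬝ᵥ y) * ((b i).ofLp ⬝ᵥ z) = y ⬝ᵥ z := by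
    intro y z
    have := b.sum_inner_mul_inner (WithLp.toLp 2 y) (WithLp.toLp 2 z)
    simp only [EuclideanSpace.inner_eq_star_dotProduct, star_trivial] at this
    rw [dotProduct_comm y z, ← this]
    exact sum_congr rfl fun i _ => by rw [dotProduct_comm z]
  have hcoef : ∀ i y, (b i).ofLp ⬝ᵥ (A *ᵥ y) = hA.eigenvalues i * ((b i).ofLp ⬝ᵥ y) := by
    intro i y
    rw [dotProduct_mulVec, ← mulVec_transpose, hT, hA.mulVec_eigenvectorBasis, smul_dotProduct]
    rfl
  have hu0 : ∀ i, i ≠ i₀ → (b i).ofLp ⬝ᵥ u = 0 := by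
    intro i hi
    have h1 := hcoef i u
    rw [hAu, dotProduct_smul, smul_eq_mul] at h1
    have h2 := (le_abs_self _).trans (hle i hi)
    have h3 : (hA.eigenvalues i₀ - hA.eigenvalues i) * ((b i).ofLp ⬝ᵥ u) = 0 := by linarith
    rcases mul_eq_zero.1 h3 with h | h
    · linarith
    · exact h
  have hx0 : (b i₀).ofLp ⬝ᵥ x = 0 := by
    have h1 := hparseval u x
    rw [sum_eq_single_of_mem i₀ (mem_univ _) fun i _ hi => by rw [hu0 i hi, zero_mul], hux] at h1
    rcases mul_eq_zero.1 h1 with h | h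
    · have h2 := hparseval u u
      rw [sum_eq_single_of_mem i₀ (mem_univ _) fun i _ hi => by rw [hu0 i hi, zero_mul], h,
        zero_mul] at h2
      exact absurd (dotProduct_self_eq_zero.1 h2.symm) hu
    · exact h
  rw [← hparseval, ← hparseval x x, mul_sum]
  refine sum_le_sum fun i _ => ?_
  rw [hcoef]
  by_cases hi : i = i₀
  · rw [hi, hx0]; simp
  · have := hle i hi
    have h1 : hA.eigenvalues i ^ 2 ≤ lam ^ 2 :=
      sq_le_sq' (by linarith [abs_le.1 this]) (abs_le.1 this).2
    nlinarith [mul_self_nonneg ((b i).ofLp ⬝ᵥ x)]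

end Spectral

section Graph

open Matrix

variable {V : Type*} [Fintype V] [DecidableEq V] (G : SimpleGraph V) [DecidableRel G.Adj]

/-- The number of neighbours of `v` in `U`. -/
def degIn (U : Finset V) (v : V) : ℕ := #{u ∈ U | G.Adj v u}

/-- The set of vertices with a neighbour in `S`. -/
def nbhd (S : Finset V) : Finset V := {v | ∃ s ∈ S, G.Adj s v}

variable {G}

omit [DecidableEq V] in
lemma mem_nbhd {S : Finset V} {v : V} : v ∈ nbhd G S ↔ ∃ s ∈ S, G.Adj s v := by
  simp [nbhd]

lemma nbhd_union (S T : Finset V) : nbhd G (S ∪ T) = nbhd G S ∪ nbhd G T := by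
  ext v; simp only [mem_nbhd, mem_union, or_and_right, exists_or]

omit [DecidableEq V] in
lemma nbhd_mono {S T : Finset V} (h : S ⊆ T) : nbhd G S ⊆ nbhd G T := by
  intro v hv
  obtain ⟨s, hs, h'⟩ := mem_nbhd.1 hv
  exact mem_nbhd.2 ⟨s, h hs, h'⟩

omit [DecidableEq V] in
lemma degIn_univ (v : V) : degIn G univ v = G.degree v := by
  rw [← G.card_neighborFinset_eq_degree, degIn]
  congr 1
  ext u
  simp

lemma degIn_eq_card_inter (U : Finset V) (v : V) : degIn G U v = #(G.neighborFinset v ∩ U) := by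
  rw [degIn]
  congr 1
  ext u
  simp [and_comm]

/-- The vertices whose number of neighbours in `U` is less than half of the average. -/
def fewNbrs (G : SimpleGraph V) [DecidableRel G.Adj] (d : ℕ) (U : Finset V) : Finset V :=
  {v | 2 * Fintype.card V * degIn G U v < d * #U}

end Graph

section NDL

open Matrix

variable {n d : ℕ} {eta : ℝ} {G : SimpleGraph (Fin n)} [DecidableRel G.Adj]

/-- The consequences of being an `(n, d, λ)`-graph with `λ ≤ η d` that percolation relies on:
regularity, the variance form of the expander mixing lemma, and a bound on the number of closed
walks. -/
structure Pseudorandom (G : SimpleGraph (Fin n)) [DecidableRel G.Adj] (d : ℕ) (eta : ℝ) :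
    Prop where
  regular : G.IsRegularOfDegree d
  sum_sq_le (U : Finset (Fin n)) :
    ∑ v, ((degIn G U v : ℝ) - d * #U / n) ^ 2 ≤ (eta * d) ^ 2 * #U
  trace_le (k : ℕ) :
    (G.adjMatrix ℝ ^ (k + 2)).trace ≤ (d : ℝ) ^ (k + 2) + (eta * d) ^ k * (n * d)
  le_card : (n : ℝ) * d ≤ d ^ 2 + n * (eta * d) ^ 2

lemma trace_adjMatrix_sq (hreg : G.IsRegularOfDegree d) :
    (G.adjMatrix ℝ ^ 2).trace = n * d := by
  have : ∀ i, (G.adjMatrix ℝ * G.adjMatrix ℝ) i i = d := fun i => by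
    rw [G.adjMatrix_mul_self_apply_self, hreg i]
  simp [Matrix.trace, sq, this]

lemma pseudorandom_of_eigenvalues (hd : 0 < d) (hA : (G.adjMatrix ℝ).IsHermitian)
    (hreg : G.IsRegularOfDegree d) {i₀ : Fin n} (hi₀ : hA.eigenvalues i₀ = d)
    (h0 : 0 ≤ eta) (h1 : eta < 1) (hle : ∀ i, i ≠ i₀ → |hA.eigenvalues i| ≤ eta * d) :
    Pseudorandom G d eta := by
  have hd' : (0 : ℝ) < d := by exact_mod_cast hd
  have hn' : (0 : ℝ) < n := by exact_mod_cast i₀.pos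
  have hsq : ∑ i, hA.eigenvalues i ^ 2 = n * d := by
    rw [← trace_pow_eq_sum_eigenvalues_pow, trace_adjMatrix_sq hreg]
  refine ⟨hreg, fun U => ?_, fun k => ?_, ?_⟩
  · set x : Fin n → ℝ := fun v => (if v ∈ U then 1 else 0) - #U / n
    have hu : (fun _ => 1 : Fin n → ℝ) ≠ 0 := fun h => by
      have := congrFun h i₀
      simp at this
    have hAu : G.adjMatrix ℝ *ᵥ (fun _ => 1 : Fin n → ℝ) =
        hA.eigenvalues i₀ • (fun _ => 1 : Fin n → ℝ) := by
      ext v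
      have := G.adjMatrix_mulVec_const_apply_of_regular (α := ℝ) (a := 1) hreg (v := v)
      rw [hi₀]
      simpa [Function.const_def] using this
    have hux : (fun _ => 1 : Fin n → ℝ) ⬝ᵥ x = 0 := by
      simp [dotProduct, x]
      field_simp
      simp
    have hlam : eta * d < hA.eigenvalues i₀ := by rw [hi₀]; nlinarith
    have key := dotProduct_self_mulVec_le hA hlam hle hu hAu hux
    have hAx : ∀ v, (G.adjMatrix ℝ *ᵥ x) v = (degIn G U v : ℝ) - d * #U / n := by
      intro v
      rw [G.adjMatrix_mulVec_apply, degIn_eq_card_inter]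
      simp only [x, sum_sub_distrib, sum_const, G.card_neighborFinset_eq_degree, hreg v]
      rw [sum_ite_mem]
      simp
      ring
    have hxx : x ⬝ᵥ x ≤ #U := by
      have : ∀ v, x v * x v = (if v ∈ U then (1 - 2 * (#U / n) : ℝ) else 0) + (#U / n) ^ 2 := by
        intro v
        simp only [x]
        split_ifs <;> ring
      simp only [dotProduct, this, sum_add_distrib, sum_ite_mem, univ_inter, sum_const,
        card_univ, Fintype.card_fin, nsmul_eq_mul]
      have : (#U : ℝ) * (1 - 2 * (#U / n)) + n * (#U / n) ^ 2 = #U - #U ^ 2 / n := by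
        field_simp; ring
      rw [this]
      have : (0 : ℝ) ≤ #U ^ 2 / n := by positivity
      linarith
    calc ∑ v, ((degIn G U v : ℝ) - d * #U / n) ^ 2
        = (G.adjMatrix ℝ *ᵥ x) ⬝ᵥ (G.adjMatrix ℝ *ᵥ x) := by
          simp only [dotProduct, hAx, sq]
      _ ≤ (eta * d) ^ 2 * (x ⬝ᵥ x) := key
      _ ≤ (eta * d) ^ 2 * #U := by gcongr
  · rw [trace_pow_eq_sum_eigenvalues_pow hA, ← hsq, mul_sum,
      ← add_sum_erase _ _ (mem_univ i₀), hi₀]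
    gcongr
    refine (sum_le_sum fun i hi => ?_).trans
      (sum_le_sum_of_subset_of_nonneg (erase_subset i₀ univ) fun i _ _ => by positivity)
    calc hA.eigenvalues i ^ (k + 2) = hA.eigenvalues i ^ k * hA.eigenvalues i ^ 2 := pow_add _ _ _
      _ ≤ |hA.eigenvalues i ^ k| * hA.eigenvalues i ^ 2 := by gcongr; exact le_abs_self _
      _ ≤ (eta * d) ^ k * hA.eigenvalues i ^ 2 := by
          rw [abs_pow]; gcongr; exact hle i (ne_of_mem_erase hi)
  · rw [← hsq, ← add_sum_erase _ _ (mem_univ i₀), hi₀]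
    gcongr
    calc ∑ i ∈ univ.erase i₀, hA.eigenvalues i ^ 2
        ≤ ∑ i ∈ univ.erase i₀, (eta * d) ^ 2 := by
          refine sum_le_sum fun i hi => ?_
          rw [← sq_abs]
          gcongr
          exact hle i (ne_of_mem_erase hi)
      _ ≤ ∑ i : Fin n, (eta * d) ^ 2 :=
          sum_le_sum_of_subset_of_nonneg (erase_subset i₀ univ) fun i _ _ => by positivity
      _ = n * (eta * d) ^ 2 := by simp

lemma card_fewNbrs_le (hG : Pseudorandom G d eta) (hd : 0 < d) (U : Finset (Fin n)) {t : ℝ}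
    (ht : 0 < t) (hU : t * n ≤ #U) : (#(fewNbrs G d U) : ℝ) ≤ 4 * eta ^ 2 / t * n := by
  rcases Nat.eq_zero_or_pos n with rfl | hn
  · have : fewNbrs G d U = ∅ := by
      ext v; exact v.elim0
    simp [this]
  have hn' : (0 : ℝ) < n := by exact_mod_cast hn
  have hd' : (0 : ℝ) < d := by exact_mod_cast hd
  have hU' : (0 : ℝ) < #U := lt_of_lt_of_le (by positivity) hU
  have h1 : #(fewNbrs G d U) * ((d : ℝ) * #U / (2 * n)) ^ 2 ≤ (eta * d) ^ 2 * #U := by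
    refine le_trans ?_ (hG.sum_sq_le U)
    rw [← nsmul_eq_mul, ← sum_const]
    refine (sum_le_sum fun v hv => ?_).trans
      (sum_le_sum_of_subset_of_nonneg (subset_univ (fewNbrs G d U)) fun i _ _ => sq_nonneg _)
    have hv' : 2 * n * degIn G U v < d * #U := by simpa [fewNbrs] using hv
    have hv2 : (2 * n * degIn G U v : ℝ) ≤ d * #U := by exact_mod_cast hv'.le
    have e : (d : ℝ) * #U / n = 2 * (d * #U / (2 * n)) := by field_simp
    have : (degIn G U v : ℝ) ≤ d * #U / (2 * n) := by
      rw [le_div_iff₀ (by positivity)]; linarith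
    rw [e, ← neg_sq ((degIn G U v : ℝ) - _)]
    refine pow_le_pow_left₀ (by positivity) (by linarith) 2
  have h2 : (#(fewNbrs G d U) : ℝ) * #U ≤ 4 * eta ^ 2 * n ^ 2 := by
    have e : #(fewNbrs G d U) * ((d : ℝ) * #U / (2 * n)) ^ 2 =
      (#(fewNbrs G d U) * #U) * (d ^ 2 * #U / (4 * n ^ 2)) := by field_simp; ring
    have e2 : (eta * d) ^ 2 * (#U : ℝ) = (4 * eta ^ 2 * n ^ 2) * (d ^ 2 * #U / (4 * n ^ 2)) := by
      field_simp
    rw [e, e2] at h1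
    exact le_of_mul_le_mul_right h1 (by positivity)
  rw [div_mul_eq_mul_div, le_div_iff₀ ht]
  have h3 : (#(fewNbrs G d U) : ℝ) * (t * n) ≤ 4 * eta ^ 2 * n ^ 2 :=
    (mul_le_mul_of_nonneg_left hU (by positivity)).trans h2
  nlinarith

end NDL

section Moments

variable {V : Type*} [Fintype V] [DecidableEq V]

lemma ind_le_exp_mul_pow {m s : ℝ} (hs : 0 ≤ s) (k : ℕ) :
    ind (m ≤ k) ≤ Real.exp (-(s * m)) * Real.exp s ^ k := by
  refine ind_le (by positivity) fun h => ?_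
  rw [← Real.exp_nat_mul, ← Real.exp_add]
  exact Real.one_le_exp (by nlinarith)

lemma prob_le_card_le {p : ℝ} (h0 : 0 ≤ p) (h1 : p ≤ 1) (m : ℝ) {s : ℝ} (hs : 0 ≤ s) :
    prob p (fun P : Finset V => m ≤ #P) ≤
      Real.exp (Fintype.card V * (p * (Real.exp s - 1)) - s * m) := by
  have hs1 : 0 ≤ Real.exp s - 1 := by linarith [Real.one_le_exp hs]
  have := expect_subset_mul_pow p (Real.exp s) (disjoint_empty_left (univ : Finset V))
  simp only [ind_true (empty_subset _), one_mul, inter_univ, card_empty, pow_zero,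
    card_univ] at this
  calc prob p (fun P : Finset V => m ≤ #P)
      ≤ expect p (fun P : Finset V => Real.exp (-(s * m)) * Real.exp s ^ #P) :=
        expect_mono h0 h1 fun P => ind_le_exp_mul_pow hs _
    _ = Real.exp (-(s * m)) * (1 + p * (Real.exp s - 1)) ^ Fintype.card V := by
        rw [expect_mul, this]
    _ ≤ Real.exp (-(s * m)) * Real.exp (Fintype.card V * (p * (Real.exp s - 1))) := by
        gcongr
        exact one_add_pow_le_exp (by positivity) _
    _ = _ := by rw [← Real.exp_add]; ring_nf

lemma sum_sum_prob_union_subset (p : ℝ) :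
    ∑ A : Finset V, ∑ F : Finset V, prob p (fun P => A ∪ F ⊆ P) =
      (1 + 3 * p) ^ Fintype.card V := by
  simp only [prob]
  simp_rw [← expect_sum]
  have h : ∀ P : Finset V, ∑ A : Finset V, ∑ F : Finset V, ind (A ∪ F ⊆ P) = (4 : ℝ) ^ #P := by
    intro P
    have e : ∀ A F : Finset V, ind (A ∪ F ⊆ P) =
        (if A ∈ P.powerset then (1 : ℝ) else 0) * (if F ∈ P.powerset then 1 else 0) := by
      intro A F
      simp only [ind, union_subset_iff, mem_powerset]
      by_cases hA : A ⊆ P <;> by_cases hF : F ⊆ P <;> simp [hA, hF]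
    simp_rw [e]
    rw [← Finset.sum_mul_sum]
    simp only [sum_ite_mem, univ_inter, sum_const, card_powerset, nsmul_eq_mul, mul_one]
    push_cast
    rw [← mul_pow]
    norm_num
  simp_rw [h]
  have := expect_subset_mul_pow p 4 (disjoint_empty_left (univ : Finset V))
  simp only [ind_true (empty_subset _), one_mul, inter_univ, card_empty, pow_zero,
    card_univ] at this
  rw [this]
  norm_num
  ring

/-- A random set is unlikely to contain a pair of sets `A`, `F` together with many elements of a
small set `Φ A F` which they determine. -/
lemma prob_exists_many_le {p : ℝ} (h0 : 0 ≤ p) (h1 : p ≤ 1)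
    (Φ : Finset V → Finset V → Finset V) (hΦ : ∀ A F, Disjoint (A ∪ F) (Φ A F))
    {s : ℝ} (m : ℝ) (hs : 0 ≤ s) (hcard : ∀ A F, Real.exp s * #(Φ A F) ≤ Fintype.card V) :
    prob p (fun P => ∃ A F, A ∪ F ⊆ P ∧ m ≤ #(P ∩ Φ A F)) ≤
      Real.exp (4 * (p * Fintype.card V) - s * m) := by
  have hs1 : 0 ≤ Real.exp s - 1 := by linarith [Real.one_le_exp hs]
  have hpt : ∀ P : Finset V, ind (∃ A F, A ∪ F ⊆ P ∧ m ≤ #(P ∩ Φ A F)) ≤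
      ∑ A : Finset V, ∑ F : Finset V,
        Real.exp (-(s * m)) * (ind (A ∪ F ⊆ P) * Real.exp s ^ #(P ∩ Φ A F)) := by
    intro P
    have hnn : ∀ A F : Finset V,
        0 ≤ Real.exp (-(s * m)) * (ind (A ∪ F ⊆ P) * Real.exp s ^ #(P ∩ Φ A F)) := fun A F =>
      mul_nonneg (Real.exp_pos _).le (mul_nonneg (ind_nonneg _) (by positivity))
    refine ind_le (sum_nonneg fun _ _ => sum_nonneg fun _ _ => hnn _ _) ?_
    rintro ⟨A, F, h, hm⟩
    refine le_trans ?_ (single_le_sum (f := fun A => ∑ F : Finset V, Real.exp (-(s * m)) *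
      (ind (A ∪ F ⊆ P) * Real.exp s ^ #(P ∩ Φ A F)))
      (fun A _ => sum_nonneg fun F _ => hnn A F) (mem_univ A))
    refine le_trans ?_ (single_le_sum (f := fun F => Real.exp (-(s * m)) *
      (ind (A ∪ F ⊆ P) * Real.exp s ^ #(P ∩ Φ A F))) (fun F _ => hnn A F) (mem_univ F))
    rw [ind_true h, one_mul]
    have := ind_le_exp_mul_pow (m := m) hs #(P ∩ Φ A F)
    rwa [ind_true hm] at this
  refine (expect_mono h0 h1 hpt).trans ?_
  simp_rw [expect_sum, expect_mul]
  have hone : ∀ A F : Finset V, (1 + p * (Real.exp s - 1)) ^ #(Φ A F) ≤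
      Real.exp (p * Fintype.card V) := by
    intro A F
    refine (one_add_pow_le_exp (by positivity) _).trans (Real.exp_le_exp.2 ?_)
    have := hcard A F
    have h2 : (#(Φ A F) : ℝ) * (Real.exp s - 1) ≤ Fintype.card V := by
      nlinarith [Nat.cast_nonneg (α := ℝ) #(Φ A F)]
    calc (#(Φ A F) : ℝ) * (p * (Real.exp s - 1)) = p * (#(Φ A F) * (Real.exp s - 1)) := by ring
      _ ≤ _ := by gcongr
  calc ∑ A : Finset V, ∑ F : Finset V, Real.exp (-(s * m)) *
        expect p (fun P => ind (A ∪ F ⊆ P) * Real.exp s ^ #(P ∩ Φ A F))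
      ≤ ∑ A : Finset V, ∑ F : Finset V, Real.exp (-(s * m)) *
          (prob p (fun P => A ∪ F ⊆ P) * Real.exp (p * Fintype.card V)) := by
        gcongr with A _ F _
        rw [expect_subset_mul_pow p _ (hΦ A F), prob_subset]
        gcongr
        exact hone A F
    _ = Real.exp (-(s * m)) * Real.exp (p * Fintype.card V) * (1 + 3 * p) ^ Fintype.card V := by
        rw [← sum_sum_prob_union_subset p]
        simp_rw [mul_sum]
        refine sum_congr rfl fun A _ => sum_congr rfl fun F _ => by ring
    _ ≤ Real.exp (-(s * m)) * Real.exp (p * Fintype.card V) *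
          Real.exp (Fintype.card V * (3 * p)) := by
        gcongr
        exact one_add_pow_le_exp (by positivity) _
    _ = _ := by
        rw [← Real.exp_add, ← Real.exp_add]; ring_nf

end Moments

section Expansion

variable {n d : ℕ} {eta : ℝ} {G : SimpleGraph (Fin n)} [DecidableRel G.Adj]

/-- The neighbourhood of a nonempty set; all vertices for the empty set. -/
def nbhdOrUniv (G : SimpleGraph (Fin n)) [DecidableRel G.Adj] (A : Finset (Fin n)) :
    Finset (Fin n) :=
  if A = ∅ then univ else nbhd G A

open Classical in
/-- The vertices outside `A ∪ F` with unusually few neighbours in the part of `nbhdOrUniv G A`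
not adjacent to `F`, provided this part has at least `t * n` vertices. -/
noncomputable def poorSet (G : SimpleGraph (Fin n)) [DecidableRel G.Adj] (d : ℕ) (t : ℝ)
    (A F : Finset (Fin n)) : Finset (Fin n) :=
  if t * n ≤ #(nbhdOrUniv G A \ nbhd G F) then
    fewNbrs G d (nbhdOrUniv G A \ nbhd G F) \ (A ∪ F)
  else ∅

/-- No pair of subsets of `P` has `m` poor vertices inside `P`. -/
def Expanding (G : SimpleGraph (Fin n)) [DecidableRel G.Adj] (d : ℕ) (t m : ℝ)
    (P : Finset (Fin n)) : Prop :=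
  ∀ A F, A ∪ F ⊆ P → (#(P ∩ poorSet G d t A F) : ℝ) < m

lemma prob_not_expanding_le (hG : Pseudorandom G d eta) (hd : 0 < d) {p : ℝ} (h0 : 0 ≤ p)
    (h1 : p ≤ 1) {t s : ℝ} (m : ℝ) (ht : 0 < t) (hs : 0 ≤ s)
    (hts : Real.exp s * (4 * eta ^ 2 / t) ≤ 1) :
    prob p (fun P => ¬ Expanding G d t m P) ≤ Real.exp (4 * (p * n) - s * m) := by
  have key := prob_exists_many_le h0 h1 (poorSet G d t) (s := s) (fun A F => ?_) m hs
    (fun A F => ?_)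
  · rw [Fintype.card_fin] at key
    refine le_trans (prob_mono h0 h1 fun P hP => ?_) key
    simpa [Expanding] using hP
  · unfold poorSet
    split_ifs
    · exact disjoint_sdiff
    · exact disjoint_empty_right _
  · rw [Fintype.card_fin]
    unfold poorSet
    split_ifs with h
    · have h2 := card_fewNbrs_le hG hd _ ht h
      have h3 : (#(fewNbrs G d (nbhdOrUniv G A \ nbhd G F) \ (A ∪ F)) : ℝ) ≤
          #(fewNbrs G d (nbhdOrUniv G A \ nbhd G F)) := by
        exact_mod_cast card_le_card sdiff_subset
      calc Real.exp s * _ ≤ Real.exp s * (4 * eta ^ 2 / t * n) := by gcongr; exact h3.trans h2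
        _ = (Real.exp s * (4 * eta ^ 2 / t)) * n := by ring
        _ ≤ 1 * n := by gcongr
        _ = n := one_mul _
    · simp

lemma Expanding.card_nbhd_inter {P A B : Finset (Fin n)} {t a τ : ℝ}
    (h : Expanding G d t (a * (n / d) / 2) P) (hd : 0 < d) (ha : a ≤ 1) (hτ : 0 ≤ τ)
    (ht : t ≤ τ / 2)
    (hA : A ⊆ P) (hB : B ⊆ P) (hAB : Disjoint A B) (hU : τ * n ≤ #(nbhdOrUniv G A))
    (hBcard : a * (n / d) ≤ #B) :
    a * τ / 8 * n ≤ #(nbhd G B ∩ nbhdOrUniv G A) := by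
  set U₀ := nbhdOrUniv G A with hU₀
  have hd' : (0 : ℝ) < d := by exact_mod_cast hd
  obtain ⟨F, hF, hmax⟩ := exists_max_image
    (B.powerset.filter fun F => (#F : ℝ) * (d * τ / 4) ≤ #(nbhd G F ∩ U₀)) card
    ⟨∅, by simp⟩
  rw [mem_filter, mem_powerset] at hF
  have hsub : (#(nbhd G F ∩ U₀) : ℝ) ≤ #(nbhd G B ∩ U₀) := by
    exact_mod_cast card_le_card (inter_subset_inter_right (nbhd_mono hF.1))
  by_cases hbig : τ * n / 2 ≤ #(nbhd G F ∩ U₀)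
  · have : a * τ / 8 * n ≤ τ * n / 2 := by
      have : 0 ≤ τ * n := by positivity
      nlinarith
    linarith
  push Not at hbig
  have hUcard : τ / 2 * n ≤ #(U₀ \ nbhd G F) := by
    have := card_sdiff_add_card_inter U₀ (nbhd G F)
    rw [inter_comm] at this
    have : (#(U₀ \ nbhd G F) : ℝ) + #(nbhd G F ∩ U₀) = #U₀ := by exact_mod_cast this
    linarith
  have hpoor : B \ F ⊆ P ∩ poorSet G d t A F := by
    intro x hx
    rw [mem_sdiff] at hx
    have hxA : x ∉ A := disjoint_right.1 hAB hx.1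
    rw [mem_inter, poorSet,
      if_pos ((mul_le_mul_of_nonneg_right ht (Nat.cast_nonneg _)).trans hUcard),
      mem_sdiff, mem_union]
    refine ⟨hB hx.1, ?_, by tauto⟩
    have hnot : ¬ ((#(insert x F) : ℝ) * (d * τ / 4) ≤ #(nbhd G (insert x F) ∩ U₀)) := by
      intro hcon
      have := hmax (insert x F) (by
        rw [mem_filter, mem_powerset]
        exact ⟨insert_subset hx.1 hF.1, hcon⟩)
      rw [card_insert_of_notMem hx.2] at this
      omega
    push Not at hnot
    rw [card_insert_of_notMem hx.2] at hnot
    have hsplit : #(nbhd G F ∩ U₀) + degIn G (U₀ \ nbhd G F) x ≤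
        #(nbhd G (insert x F) ∩ U₀) := by
      rw [degIn, ← card_union_of_disjoint]
      · refine card_le_card (union_subset
          (inter_subset_inter_right (nbhd_mono (subset_insert _ _))) fun y hy => ?_)
        rw [mem_filter, mem_sdiff] at hy
        exact mem_inter.2 ⟨mem_nbhd.2 ⟨x, mem_insert_self _ _, hy.2⟩, hy.1.1⟩
      · rw [disjoint_left]
        intro y hy hy'
        rw [mem_filter, mem_sdiff] at hy'
        exact hy'.1.2 (mem_inter.1 hy).1
    have hsplit' : (#(nbhd G F ∩ U₀) : ℝ) + degIn G (U₀ \ nbhd G F) x ≤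
        #(nbhd G (insert x F) ∩ U₀) := by exact_mod_cast hsplit
    have hdeg : (degIn G (U₀ \ nbhd G F) x : ℝ) < d * τ / 4 := by
      push_cast at hnot
      linarith [hF.2]
    simp only [fewNbrs, mem_filter, mem_univ, true_and, Fintype.card_fin]
    have hn : (0 : ℝ) < n := by exact_mod_cast x.pos
    have : (2 * n * degIn G (U₀ \ nbhd G F) x : ℝ) < d * #(U₀ \ nbhd G F) := by
      calc (2 * n * degIn G (U₀ \ nbhd G F) x : ℝ) < 2 * n * (d * τ / 4) := by gcongr
        _ = d * (τ / 2 * n) := by ring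
        _ ≤ _ := by gcongr
    exact_mod_cast this
  have h1 := h A F (union_subset hA (hF.1.trans hB))
  have h2 : (#(B \ F) : ℝ) ≤ #(P ∩ poorSet G d t A F) := by exact_mod_cast card_le_card hpoor
  have h3 : (#(B \ F) : ℝ) + #F = #B := by exact_mod_cast card_sdiff_add_card_eq_card hF.1
  have h4 : a * (n / d) / 2 ≤ #F := by linarith
  calc a * τ / 8 * n = a * (n / d) / 2 * (d * τ / 4) := by field_simp; ring
    _ ≤ #F * (d * τ / 4) := by gcongr
    _ ≤ #(nbhd G F ∩ U₀) := hF.2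
    _ ≤ _ := hsub

/-- Disjoint large subsets of an expanding set have many common neighbours. -/
lemma Expanding.card_common_nbhd {P A B : Finset (Fin n)} {a : ℝ}
    (h : Expanding G d (a / 16) (a * (n / d) / 2) P) (hd : 0 < d) (hn : 0 < n) (ha0 : 0 < a)
    (ha : a ≤ 1) (hA : A ⊆ P) (hB : B ⊆ P) (hAB : Disjoint A B)
    (hAcard : a * (n / d) ≤ #A) (hBcard : a * (n / d) ≤ #B) :
    a ^ 2 / 64 * n ≤ #(nbhd G B ∩ nbhd G A) := by
  have hd' : (0 : ℝ) < d := by exact_mod_cast hd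
  have hn' : (0 : ℝ) < n := by exact_mod_cast hn
  have hne : A ≠ ∅ := by
    rintro rfl
    rw [card_empty, Nat.cast_zero] at hAcard
    have : 0 < a * (n / d) := by positivity
    linarith
  have h1 := h.card_nbhd_inter (A := ∅) (B := A) (τ := 1) hd ha zero_le_one (by linarith)
    (empty_subset _) hA (disjoint_empty_left _) (by simp [nbhdOrUniv]) hAcard
  have h2 := h.card_nbhd_inter (A := A) (B := B) (τ := a / 8) hd ha (by positivity) (by linarith)
    hA hB hAB (by
      rw [nbhdOrUniv, if_pos rfl, inter_univ] at h1
      rw [nbhdOrUniv, if_neg hne]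
      linarith) hBcard
  rw [nbhdOrUniv, if_neg hne] at h2
  calc a ^ 2 / 64 * n = a * (a / 8) / 8 * n := by ring
    _ ≤ _ := h2

end Expansion

section Boundary

variable {V : Type*} [Fintype V] [DecidableEq V] {G : SimpleGraph V} [DecidableRel G.Adj]

/-- The outer vertex boundary of `S`. -/
def bdry (G : SimpleGraph V) [DecidableRel G.Adj] (S : Finset V) : Finset V := nbhd G S \ S

/-- Every vertex of `S` can be reached from `R ⊆ S` inside `S`. -/
def Rooted (G : SimpleGraph V) (R S : Finset V) : Prop :=
  R ⊆ S ∧ ∀ Z : Finset V, R ⊆ Z → (∀ x ∈ Z, ∀ y ∈ S, G.Adj x y → y ∈ Z) → S ⊆ Z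

lemma disjoint_bdry (S : Finset V) : Disjoint S (bdry G S) := disjoint_sdiff

lemma Rooted.subset_of_disjoint {R S T X : Finset V} (hS : Rooted G R S) (hT : Rooted G R T)
    (hSX : S \ R ⊆ X) (hTX : Disjoint X (bdry G T)) : S ⊆ T := by
  refine hS.2 T hT.1 fun x hx y hy hxy => ?_
  by_contra hyT
  have hyb : y ∈ bdry G T := mem_sdiff.2 ⟨mem_nbhd.2 ⟨x, hx, hxy⟩, hyT⟩
  exact disjoint_left.1 hTX (hSX (mem_sdiff.2 ⟨hy, fun h => hyT (hT.1 h)⟩)) hyb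

open Classical in
lemma sum_rooted_le_one {q : ℝ} (h0 : 0 ≤ q) (h1 : q ≤ 1) (R : Finset V) :
    ∑ S : Finset V with Rooted G R S, q ^ #(S \ R) * (1 - q) ^ #(bdry G S) ≤ 1 := by
  have hdisj : ∀ S : Finset V, Disjoint (S \ R) (bdry G S) := fun S =>
    (disjoint_bdry S).mono_left sdiff_subset
  rw [sum_congr rfl fun S _ => (prob_subset_disjoint q (hdisj S)).symm]
  refine sum_prob_le_one h0 h1 _ _ fun X S hS T hT hSX hTX => ?_
  rw [mem_filter] at hS hT
  exact Subset.antisymm (hS.2.subset_of_disjoint hT.2 hSX.1 hTX.2)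
    (hT.2.subset_of_disjoint hS.2 hTX.1 hSX.2)

/-- The change-of-measure bound for closed-off rooted sets with few roots. -/
lemma prob_exists_rooted_le {p q M L z : ℝ} (hp0 : 0 ≤ p) (hp1 : p ≤ 1) (hq0 : 0 ≤ q)
    (hq1 : q ≤ 1) (hM : 0 ≤ M) (hz : 0 ≤ z) (W : Finset V → Finset V → Prop)
    (hWL : ∀ R S, Rooted G R S → W R S → #R ≤ L)
    (hWM : ∀ R S, Rooted G R S → W R S → p ^ #(S \ R) * (1 - p) ^ #(bdry G S) ≤
      M * (q ^ #(S \ R) * (1 - q) ^ #(bdry G S))) :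
    prob p (fun P => ∃ R S, Rooted G R S ∧ W R S ∧ S ⊆ P ∧ Disjoint P (bdry G S)) ≤
      Real.exp (Fintype.card V * (p * Real.exp (-z)) + z * L) * M := by
  classical
  have hp1' : 0 ≤ 1 - p := by linarith
  have hq1' : 0 ≤ 1 - q := by linarith
  have hR : ∀ R : Finset V,
      ∑ S : Finset V with Rooted G R S ∧ W R S,
        prob p (fun P => S ⊆ P ∧ Disjoint P (bdry G S)) ≤
      Real.exp (z * L) * (p * Real.exp (-z)) ^ #R * M := by
    intro R
    have hterm : ∀ S ∈ univ.filter (fun S : Finset V => Rooted G R S ∧ W R S),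
        prob p (fun P => S ⊆ P ∧ Disjoint P (bdry G S)) ≤
          Real.exp (z * L) * (p * Real.exp (-z)) ^ #R * M *
            (q ^ #(S \ R) * (1 - q) ^ #(bdry G S)) := by
      intro S hS
      obtain ⟨hRS, hW⟩ := (mem_filter.1 hS).2
      rw [prob_subset_disjoint p (disjoint_bdry S),
        ← card_sdiff_add_card_eq_card hRS.1, pow_add]
      have h1 : 1 ≤ Real.exp (z * L) * Real.exp (-z) ^ #R := by
        rw [← Real.exp_nat_mul, ← Real.exp_add]
        exact Real.one_le_exp (by nlinarith [hWL R S hRS hW])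
      have h2 := hWM R S hRS hW
      have h3 : 0 ≤ M * (q ^ #(S \ R) * (1 - q) ^ #(bdry G S)) := by positivity
      calc p ^ #(S \ R) * p ^ #R * (1 - p) ^ #(bdry G S)
          = p ^ #R * (p ^ #(S \ R) * (1 - p) ^ #(bdry G S)) := by ring
        _ ≤ p ^ #R * (M * (q ^ #(S \ R) * (1 - q) ^ #(bdry G S))) := by gcongr
        _ ≤ (Real.exp (z * L) * Real.exp (-z) ^ #R) *
              (p ^ #R * (M * (q ^ #(S \ R) * (1 - q) ^ #(bdry G S)))) :=
            le_mul_of_one_le_left (by positivity) h1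
        _ = _ := by rw [mul_pow]; ring
    refine (sum_le_sum hterm).trans ?_
    rw [← mul_sum]
    refine mul_le_of_le_one_right (by positivity) ?_
    refine le_trans ?_ (sum_rooted_le_one (G := G) hq0 hq1 R)
    refine sum_le_sum_of_subset_of_nonneg (fun S hS => ?_) fun _ _ _ => by positivity
    rw [mem_filter] at hS ⊢
    exact ⟨hS.1, hS.2.1⟩
  calc prob p (fun P => ∃ R S, Rooted G R S ∧ W R S ∧ S ⊆ P ∧ Disjoint P (bdry G S))
      ≤ prob p (fun P => ∃ R ∈ (univ : Finset (Finset V)),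
          ∃ S ∈ univ.filter (fun S : Finset V => Rooted G R S ∧ W R S),
            S ⊆ P ∧ Disjoint P (bdry G S)) := by
        refine prob_mono hp0 hp1 ?_
        rintro P ⟨R, S, h, h', h''⟩
        exact ⟨R, mem_univ _, S, mem_filter.2 ⟨mem_univ _, h, h'⟩, h''⟩
    _ ≤ ∑ R : Finset V, Real.exp (z * L) * (p * Real.exp (-z)) ^ #R * M :=
        (prob_exists_le hp0 hp1 _ _).trans
          (sum_le_sum fun R _ => (prob_exists_le hp0 hp1 _ _).trans (hR R))
    _ = Real.exp (z * L) * (1 + p * Real.exp (-z)) ^ Fintype.card V * M := by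
        rw [← sum_pow_card, mul_sum, sum_mul]
    _ ≤ Real.exp (z * L) * Real.exp (Fintype.card V * (p * Real.exp (-z))) * M := by
        gcongr
        exact one_add_pow_le_exp (by positivity) _
    _ = _ := by rw [← Real.exp_add]; ring_nf

lemma pow_mul_pow_le_exp {x y u v a b E : ℝ} {i j : ℕ} (hx : 0 ≤ x) (hy : 0 ≤ y) (hu : 0 ≤ u)
    (hv : 0 ≤ v) (hxu : x ≤ Real.exp a * u) (hyv : y ≤ Real.exp b * v)
    (hE : i * a + j * b ≤ E) : x ^ i * y ^ j ≤ Real.exp E * (u ^ i * v ^ j) := by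
  calc x ^ i * y ^ j ≤ (Real.exp a * u) ^ i * (Real.exp b * v) ^ j := by gcongr
    _ = Real.exp (i * a + j * b) * (u ^ i * v ^ j) := by
        rw [Real.exp_add, Real.exp_nat_mul, Real.exp_nat_mul]; ring
    _ ≤ _ := by gcongr

/-- A union of components of the random set having few components and moderate size is unlikely to
have a boundary whose size deviates from the expected one. -/
lemma prob_bdry_deviation_le {p ς N κ z : ℝ} (hp0 : 0 < p) (hp : 4 * p ≤ ς) (hς0 : 0 < ς)
    (hς1 : ς ≤ 1 / 3) (hN : 0 ≤ N) (hpN : p * Fintype.card V ≤ 2 * N) (hκ : 1 ≤ κ * ς)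
    (hz : 0 ≤ z) :
    prob p (fun P : Finset V => ∃ R S, Rooted G R S ∧ κ * #R ≤ #S ∧ (#S : ℝ) ≤ 4 * N ∧
        16 * ς * N ≤ |p * #(bdry G S) - #S| ∧ S ⊆ P ∧ Disjoint P (bdry G S)) ≤
      2 * Real.exp (2 * N * Real.exp (-z) + z * (4 * N / κ) - 4 * ς ^ 2 * N) := by
  have hκ0 : 0 < κ := by
    by_contra h
    nlinarith
  have hp1 : p ≤ 1 := by linarith
  have hL : ∀ R S : Finset V, κ * #R ≤ #S → (#S : ℝ) ≤ 4 * N → (#R : ℝ) ≤ 4 * N / κ := by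
    intro R S h h'
    rw [le_div_iff₀ hκ0]; linarith
  have hcard : ∀ R S : Finset V, Rooted G R S → (#(S \ R) : ℝ) = #S - #R := by
    intro R S h
    rw [cast_card_sdiff h.1]
  set M := Real.exp (-(4 * ς ^ 2 * N))
  have hup := prob_exists_rooted_le (G := G) (p := p) (q := (1 - ς) * p) (M := M)
    (L := 4 * N / κ) (z := z) hp0.le hp1 (mul_nonneg (by linarith) hp0.le) (by nlinarith)
    (Real.exp_pos _).le hz
    (fun R S => κ * #R ≤ #S ∧ (#S : ℝ) ≤ 4 * N ∧ 16 * ς * N ≤ p * #(bdry G S) - #S)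
    (fun R S _ h => hL R S h.1 h.2.1) (by
      rintro R S hRS ⟨h1, h2, h3⟩
      refine pow_mul_pow_le_exp (a := ς + 2 * ς ^ 2) (b := -(ς * p)) hp0.le (by linarith)
        (mul_nonneg (by linarith) hp0.le) (by nlinarith) ?_ ?_ ?_
      · have := Real.add_one_le_exp (ς + 2 * ς ^ 2)
        have h4 : 1 ≤ Real.exp (ς + 2 * ς ^ 2) * (1 - ς) := by
          calc 1 ≤ (ς + 2 * ς ^ 2 + 1) * (1 - ς) := by nlinarith [sq_nonneg ς]
            _ ≤ _ := mul_le_mul_of_nonneg_right this (by linarith)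
        nlinarith
      · have := Real.add_one_le_exp (-(ς * p))
        calc 1 - p ≤ (-(ς * p) + 1) * (1 - (1 - ς) * p) := by
              nlinarith [mul_nonneg (mul_nonneg hς0.le (sq_nonneg p)) (by linarith : 0 ≤ 1 - ς)]
          _ ≤ _ := mul_le_mul_of_nonneg_right this (by nlinarith)
      · rw [hcard R S hRS]
        have h5 : 0 ≤ (#R : ℝ) * (ς + 2 * ς ^ 2) := by positivity
        nlinarith [mul_le_mul_of_nonneg_left h3 hς0.le,
          mul_le_mul_of_nonneg_left h2 (sq_nonneg ς), mul_nonneg (sq_nonneg ς) hN])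
  have hdown := prob_exists_rooted_le (G := G) (p := p) (q := (1 + ς) * p) (M := M)
    (L := 4 * N / κ) (z := z) hp0.le hp1 (by positivity) (by nlinarith)
    (Real.exp_pos _).le hz
    (fun R S => κ * #R ≤ #S ∧ (#S : ℝ) ≤ 4 * N ∧ 16 * ς * N ≤ -(p * #(bdry G S) - #S))
    (fun R S _ h => hL R S h.1 h.2.1) (by
      rintro R S hRS ⟨h1, h2, h3⟩
      have hq2 : 2 * ((1 + ς) * p) ≤ ς := by nlinarith
      refine pow_mul_pow_le_exp (a := -(ς - ς ^ 2)) (b := ς * p * (1 + ς)) hp0.le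
        (by linarith) (by positivity) (by nlinarith) ?_ ?_ ?_
      · have := Real.add_one_le_exp (-(ς - ς ^ 2))
        have h4 : 1 ≤ Real.exp (-(ς - ς ^ 2)) * (1 + ς) := by
          calc 1 ≤ (-(ς - ς ^ 2) + 1) * (1 + ς) := by nlinarith [pow_pos hς0 3]
            _ ≤ _ := mul_le_mul_of_nonneg_right this (by linarith)
        nlinarith
      · have := Real.add_one_le_exp (ς * p * (1 + ς))
        calc 1 - p ≤ (ς * p * (1 + ς) + 1) * (1 - (1 + ς) * p) := by
              have h6 : 0 ≤ ς * p * (ς - (1 + ς) * ((1 + ς) * p)) :=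
                mul_nonneg (by positivity) (by nlinarith)
              nlinarith
          _ ≤ _ := mul_le_mul_of_nonneg_right this (by nlinarith)
      · rw [hcard R S hRS]
        have h5 : (#R : ℝ) ≤ ς * #S := by
          calc (#R : ℝ) ≤ κ * ς * #R := le_mul_of_one_le_left (by positivity) hκ
            _ = ς * (κ * #R) := by ring
            _ ≤ _ := by gcongr
        have h6 : p * #(bdry G S) ≤ #S - 16 * ς * N := by linarith
        have h7 : ς * (1 + ς) * (p * #(bdry G S)) ≤ ς * (1 + ς) * (#S - 16 * ς * N) := by
          gcongr
        have h8 : 0 ≤ ς ^ 3 * N := by positivity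
        have h9 : 0 ≤ (#R : ℝ) * ς ^ 2 := by positivity
        nlinarith [mul_le_mul_of_nonneg_left h5 hς0.le,
          mul_le_mul_of_nonneg_left h2 (sq_nonneg ς), mul_nonneg (sq_nonneg ς) hN])
  have hbound : Real.exp (Fintype.card V * (p * Real.exp (-z)) + z * (4 * N / κ)) * M ≤
      Real.exp (2 * N * Real.exp (-z) + z * (4 * N / κ) - 4 * ς ^ 2 * N) := by
    rw [← Real.exp_add]
    refine Real.exp_le_exp.2 ?_
    have := mul_le_mul_of_nonneg_right hpN (Real.exp_pos (-z)).le
    linarith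
  refine (prob_mono hp0.le hp1 ?_).trans ((prob_or_le hp0.le hp1 _ _).trans
    ((add_le_add (hup.trans hbound) (hdown.trans hbound)).trans (two_mul _).ge))
  rintro P ⟨R, S, h, h1, h2, h3, h4⟩
  rcases le_abs.1 h3 with h3 | h3
  · exact Or.inl ⟨R, S, h, ⟨h1, h2, h3⟩, h4⟩
  · exact Or.inr ⟨R, S, h, ⟨h1, h2, h3⟩, h4⟩

end Boundary

section ShortCycles

variable {V : Type*} [Fintype V] [DecidableEq V]

/-- A random set is unlikely to contain many disjoint members of a light family of sets. -/
lemma prob_exists_disjoint_family_le {p μ : ℝ} (h0 : 0 ≤ p) (h1 : p ≤ 1)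
    (𝒯 : Finset (Finset V)) (hμ : ∑ T ∈ 𝒯, p ^ #T ≤ μ) {s : ℝ} (m : ℝ) (hs : 0 ≤ s) :
    prob p (fun P => ∃ 𝓕 ⊆ 𝒯, (𝓕 : Set (Finset V)).PairwiseDisjoint id ∧ (∀ T ∈ 𝓕, T ⊆ P) ∧
      m ≤ #𝓕) ≤ Real.exp (Real.exp s * μ - s * m) := by
  classical
  have hterm : ∀ 𝓕 ∈ 𝒯.powerset, prob p (fun P => (𝓕 : Set (Finset V)).PairwiseDisjoint id ∧
      (∀ T ∈ 𝓕, T ⊆ P) ∧ m ≤ #𝓕) ≤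
        Real.exp (-(s * m)) * ∏ T ∈ 𝓕, (Real.exp s * p ^ #T) := by
    intro 𝓕 _
    have hnn : 0 ≤ Real.exp (-(s * m)) * ∏ T ∈ 𝓕, (Real.exp s * p ^ #T) :=
      mul_nonneg (Real.exp_pos _).le (prod_nonneg fun _ _ => by positivity)
    by_cases h : (𝓕 : Set (Finset V)).PairwiseDisjoint id ∧ m ≤ #𝓕
    · calc prob p (fun P => (𝓕 : Set (Finset V)).PairwiseDisjoint id ∧
            (∀ T ∈ 𝓕, T ⊆ P) ∧ m ≤ #𝓕)
          ≤ prob p (fun P => 𝓕.biUnion id ⊆ P) :=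
            prob_mono h0 h1 fun P hP => biUnion_subset.2 hP.2.1
        _ = ∏ T ∈ 𝓕, p ^ #T := by
            rw [prob_subset, card_biUnion h.1, prod_pow_eq_pow_sum]
            rfl
        _ ≤ Real.exp (-(s * m)) * Real.exp s ^ #𝓕 * ∏ T ∈ 𝓕, p ^ #T := by
            refine le_mul_of_one_le_left (prod_nonneg fun _ _ => by positivity) ?_
            have := ind_le_exp_mul_pow (m := m) hs #𝓕
            rwa [ind_true h.2] at this
        _ = _ := by rw [prod_mul_distrib, prod_const]; ring
    · refine le_trans (prob_mono h0 h1 (F := fun _ => False) fun P hP => h ⟨hP.1, hP.2.2⟩) ?_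
      simpa [prob, ind_false, expect] using hnn
  calc prob p (fun P => ∃ 𝓕 ⊆ 𝒯, (𝓕 : Set (Finset V)).PairwiseDisjoint id ∧
        (∀ T ∈ 𝓕, T ⊆ P) ∧ m ≤ #𝓕)
      ≤ prob p (fun P => ∃ 𝓕 ∈ 𝒯.powerset, (𝓕 : Set (Finset V)).PairwiseDisjoint id ∧
        (∀ T ∈ 𝓕, T ⊆ P) ∧ m ≤ #𝓕) :=
        prob_mono h0 h1 fun P ⟨𝓕, h, h'⟩ => ⟨𝓕, mem_powerset.2 h, h'⟩
    _ ≤ ∑ 𝓕 ∈ 𝒯.powerset, Real.exp (-(s * m)) * ∏ T ∈ 𝓕, (Real.exp s * p ^ #T) :=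
        (prob_exists_le h0 h1 _ _).trans (sum_le_sum hterm)
    _ = Real.exp (-(s * m)) * ∏ T ∈ 𝒯, (1 + Real.exp s * p ^ #T) := by
        rw [prod_one_add, mul_sum]
    _ ≤ Real.exp (-(s * m)) * ∏ T ∈ 𝒯, Real.exp (Real.exp s * p ^ #T) := by
        refine mul_le_mul_of_nonneg_left ?_ (Real.exp_pos _).le
        refine prod_le_prod (fun _ _ => by positivity) fun T _ => ?_
        linarith [Real.add_one_le_exp (Real.exp s * p ^ #T)]
    _ = Real.exp (Real.exp s * (∑ T ∈ 𝒯, p ^ #T) - s * m) := by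
        rw [← Real.exp_sum, ← Real.exp_add, mul_sum]; ring_nf
    _ ≤ _ := by
        refine Real.exp_le_exp.2 ?_
        gcongr

variable (G : SimpleGraph V) [DecidableRel G.Adj]

/-- The vertex sets of size `k` traversed by a closed walk of length `k`. -/
def closedWalkSets (k : ℕ) : Finset (Finset V) :=
  {T ∈ univ.biUnion fun v => (G.finsetWalkLength k v v).image fun w => w.support.toFinset | #T = k}

/-- The sets `closedWalkSets G k` for `3 ≤ k ≤ K`. -/
def shortCycles (K : ℕ) : Finset (Finset V) := (Icc 3 K).biUnion (closedWalkSets G)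

variable {G}

lemma card_closedWalkSets_le (k : ℕ) :
    (#(closedWalkSets G k) : ℝ) ≤ (G.adjMatrix ℝ ^ k).trace := by
  have h : #(closedWalkSets G k) ≤ ∑ v, #(G.finsetWalkLength k v v) :=
    (card_filter_le _ _).trans (card_biUnion_le.trans (sum_le_sum fun v _ => card_image_le))
  refine (Nat.cast_le.2 h).trans (le_of_eq ?_)
  simp only [Matrix.trace, Matrix.diag_apply]
  push_cast
  refine sum_congr rfl fun v _ => ?_
  rw [G.adjMatrix_pow_apply_eq_card_walk, G.card_set_walk_length_eq]

lemma support_mem_shortCycles {v : V} {w : G.Walk v v} (hw : w.IsCycle) {K : ℕ}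
    (hK : #w.support.toFinset ≤ K) : w.support.toFinset ∈ shortCycles G K := by
  have hcard : #w.support.toFinset = w.length := by
    have h1 : w.support.toFinset = w.support.tail.toFinset := by
      ext x
      rw [List.mem_toFinset, List.mem_toFinset, ← w.cons_tail_support, List.mem_cons,
        List.tail_cons]
      refine ⟨?_, Or.inr⟩
      rintro (rfl | h)
      · exact w.end_mem_tail_support hw.not_nil
      · exact h
    rw [h1, List.toFinset_card_of_nodup hw.support_nodup, List.length_tail, w.length_support]
    rfl
  refine mem_biUnion.2 ⟨w.length, mem_Icc.2 ⟨hw.three_le_length, hcard ▸ hK⟩, ?_⟩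
  refine mem_filter.2 ⟨mem_biUnion.2 ⟨v, mem_univ _, mem_image.2 ⟨w, ?_, rfl⟩⟩, hcard⟩
  exact SimpleGraph.mem_finsetWalkLength_iff.2 rfl

end ShortCycles

lemma sum_shortCycles_le {n d : ℕ} {eta c : ℝ} {G : SimpleGraph (Fin n)} [DecidableRel G.Adj]
    (hG : Pseudorandom G d eta) (hd : 0 < d) (h0 : 0 ≤ eta) (h1 : eta ≤ 1 / 2) (hc0 : 0 ≤ c)
    (hc : c ≤ 2) (K : ℕ) :
    ∑ T ∈ shortCycles G K, (c / d) ^ #T ≤ K * (2 ^ K + 8 * eta * (n / d)) := by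
  have hd' : (0 : ℝ) < d := by exact_mod_cast hd
  have hk : ∀ k ∈ Icc 3 K, ∑ T ∈ closedWalkSets G k, (c / d) ^ #T ≤
      2 ^ K + 8 * eta * (n / d) := by
    intro k hk
    obtain ⟨h3, hkK⟩ := mem_Icc.1 hk
    obtain ⟨j, rfl⟩ := Nat.exists_eq_add_of_le h3
    rw [sum_congr rfl fun T hT => by rw [(mem_filter.1 hT).2], sum_const, nsmul_eq_mul]
    have htr := hG.trace_le (1 + j)
    rw [show 1 + j + 2 = 3 + j by ring] at htr
    have hce : c * eta ≤ 1 := by nlinarith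
    have hce0 : 0 ≤ c * eta := by positivity
    calc (#(closedWalkSets G (3 + j)) : ℝ) * (c / d) ^ (3 + j)
        ≤ ((d : ℝ) ^ (3 + j) + (eta * d) ^ (1 + j) * (n * d)) * (c / d) ^ (3 + j) := by
          gcongr
          exact (card_closedWalkSets_le _).trans htr
      _ = c ^ (3 + j) + (c * eta) ^ j * (c ^ 3 * eta) * (n / d) := by
          rw [div_pow]
          field_simp
          ring
      _ ≤ 2 ^ K + 1 * (2 ^ 3 * eta) * (n / d) := by
          gcongr
          · exact (pow_le_pow_left₀ hc0 hc _).trans (pow_le_pow_right₀ (by norm_num) hkK)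
          · exact pow_le_one₀ hce0 hce
      _ = _ := by ring
  calc ∑ T ∈ shortCycles G K, (c / d) ^ #T
      = ∑ k ∈ Icc 3 K, ∑ T ∈ closedWalkSets G k, (c / d) ^ #T := by
        refine sum_biUnion fun i _ j _ hij => disjoint_left.2 fun T hi hj => hij ?_
        rw [← (mem_filter.1 hi).2, (mem_filter.1 hj).2]
    _ ≤ ∑ k ∈ Icc 3 K, ((2 : ℝ) ^ K + 8 * eta * (n / d)) := sum_le_sum hk
    _ ≤ _ := by
        rw [sum_const, nsmul_eq_mul, Nat.card_Icc]
        gcongr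
        omega

section SecondMoment

variable {V : Type*} [Fintype V] [DecidableEq V]

/-- The second moment bound for the number of sets of a family contained in a random set. -/
lemma prob_add_le_sum_ind_le {ι : Type*} {p B M a : ℝ} (h0 : 0 ≤ p) (h1 : p ≤ 1) (s : Finset ι)
    (f : ι → Finset V) (hB0 : 0 ≤ B)
    (hB : ∀ t ∈ s, ∑ t' ∈ s with ¬ Disjoint (f t) (f t'), p ^ #(f t' \ f t) ≤ B)
    (hM : ∑ t ∈ s, p ^ #(f t) ≤ M) (ha : 0 < a) :
    prob p (fun P => M + a ≤ ∑ t ∈ s, ind (f t ⊆ P)) ≤ B * M / a ^ 2 := by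
  set μ := ∑ t ∈ s, p ^ #(f t) with hμ
  have hμ0 : 0 ≤ μ := sum_nonneg fun _ _ => by positivity
  set X : Finset V → ℝ := fun P => ∑ t ∈ s, ind (f t ⊆ P) with hX
  have hEX : expect p X = μ := by
    rw [hX, expect_sum]
    exact sum_congr rfl fun t _ => prob_subset p (f t)
  have hEX2 : expect p (fun P => X P ^ 2) ≤ B * μ + μ ^ 2 := by
    have : ∀ P, X P ^ 2 = ∑ t ∈ s, ∑ t' ∈ s, ind (f t ∪ f t' ⊆ P) := by
      intro P
      rw [sq, hX, sum_mul_sum]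
      refine sum_congr rfl fun t _ => sum_congr rfl fun t' _ => ?_
      by_cases h : f t ⊆ P <;> by_cases h' : f t' ⊆ P <;> simp [ind, union_subset_iff, h, h']
    simp_rw [this, expect_sum]
    have ht : ∀ t ∈ s, ∑ t' ∈ s, expect p (fun P => ind (f t ∪ f t' ⊆ P)) ≤
        p ^ #(f t) * (B + μ) := by
      intro t ht
      have hle : ∀ t' ∈ s, expect p (fun P => ind (f t ∪ f t' ⊆ P)) ≤
          p ^ #(f t) * ((if ¬ Disjoint (f t) (f t') then p ^ #(f t' \ f t) else 0) +
            p ^ #(f t')) := by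
        intro t' _
        have e := prob_subset p (f t ∪ f t')
        rw [prob] at e
        rw [e, ← union_sdiff_self_eq_union, card_union_of_disjoint disjoint_sdiff, pow_add]
        refine mul_le_mul_of_nonneg_left ?_ (by positivity)
        by_cases hd : Disjoint (f t) (f t')
        · simp [hd, sdiff_eq_self_of_disjoint hd.symm]
        · simp only [hd, not_false_eq_true, if_true]
          exact le_add_of_nonneg_right (by positivity)
      refine (sum_le_sum hle).trans ?_
      rw [← mul_sum, sum_add_distrib, ← sum_filter]
      gcongr
      exact hB t ht
    refine (sum_le_sum ht).trans (le_of_eq ?_)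
    rw [← sum_mul, ← hμ]
    ring
  have hpt : ∀ P, ind (M + a ≤ X P) ≤
      a⁻¹ ^ 2 * (X P ^ 2 + ((-2 * μ) * X P + μ ^ 2 * 1)) := by
    intro P
    have hsq : a⁻¹ ^ 2 * (X P ^ 2 + ((-2 * μ) * X P + μ ^ 2 * 1)) =
        ((X P - μ) / a) ^ 2 := by ring
    rw [hsq]
    refine ind_le (sq_nonneg _) fun h => ?_
    have : 1 ≤ (X P - μ) / a := by
      rw [le_div_iff₀ ha]; linarith
    nlinarith
  calc prob p (fun P => M + a ≤ X P)
      ≤ expect p (fun P => a⁻¹ ^ 2 * (X P ^ 2 + ((-2 * μ) * X P + μ ^ 2 * 1))) :=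
        expect_mono h0 h1 hpt
    _ = a⁻¹ ^ 2 * (expect p (fun P => X P ^ 2) + ((-2 * μ) * μ + μ ^ 2 * 1)) := by
        rw [expect_mul, expect_add, expect_add, expect_mul, expect_mul, hEX, expect_one]
    _ ≤ a⁻¹ ^ 2 * (B * μ + μ ^ 2 + ((-2 * μ) * μ + μ ^ 2 * 1)) := by gcongr
    _ = a⁻¹ ^ 2 * (B * μ) := by ring
    _ ≤ a⁻¹ ^ 2 * (B * M) := by gcongr
    _ = _ := by ring

end SecondMoment

section Cherries

variable {V : Type*} [Fintype V] [DecidableEq V] (G : SimpleGraph V) [DecidableRel G.Adj]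

/-- The triples `(u, v, w)` with `u` and `w` adjacent to `v`; `u = w` is allowed. -/
def cherries : Finset (V × V × V) := {t | G.Adj t.2.1 t.1 ∧ G.Adj t.2.1 t.2.2}

/-- The vertices of a triple. -/
def tripleSet (t : V × V × V) : Finset V := {t.1, t.2.1, t.2.2}

variable {G}

omit [Fintype V] in
lemma card_tripleSet_le (t : V × V × V) : #(tripleSet t) ≤ 3 := card_le_three

lemma sum_ind_tripleSet (P : Finset V) :
    ∑ t ∈ cherries G, ind (tripleSet t ⊆ P) = ∑ v ∈ P, (degIn G P v : ℝ) ^ 2 := by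
  have hdeg : ∀ v, (degIn G P v : ℝ) = ∑ u, if u ∈ P ∧ G.Adj v u then (1 : ℝ) else 0 := by
    intro v
    rw [degIn, ← sum_boole]
    rw [← sum_filter, ← sum_filter]
    congr 1
    ext u; simp
  have hR : ∑ v ∈ P, (degIn G P v : ℝ) ^ 2 =
      ∑ v, if v ∈ P then (degIn G P v : ℝ) ^ 2 else 0 := by simp
  rw [hR, cherries, sum_filter, Fintype.sum_prod_type]
  simp_rw [Fintype.sum_prod_type]
  rw [sum_comm]
  refine sum_congr rfl fun v _ => ?_
  rw [sq, hdeg, sum_mul_sum]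
  by_cases hv : v ∈ P
  · rw [if_pos hv]
    refine sum_congr rfl fun u _ => sum_congr rfl fun w _ => ?_
    by_cases h1 : u ∈ P <;> by_cases h2 : w ∈ P <;> by_cases h3 : G.Adj v u <;>
      by_cases h4 : G.Adj v w <;> simp [ind, tripleSet, insert_subset_iff, hv, h1, h2, h3, h4]
  · rw [if_neg hv]
    refine sum_eq_zero fun u _ => sum_eq_zero fun w _ => ?_
    simp [ind, tripleSet, insert_subset_iff, hv]

omit [Fintype V] in
lemma pow_card_sdiff_eq_prod (p : ℝ) (H T : Finset V) :
    p ^ #(T \ H) = ∏ x ∈ T, if x ∈ H then 1 else p := by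
  rw [prod_ite, prod_const_one, one_mul, prod_const]
  congr 2
  ext x; simp

omit [Fintype V] in
lemma pow_card_tripleSet_sdiff_le {p : ℝ} (h0 : 0 ≤ p) (H : Finset V) (u v w : V) :
    (if (G.Adj v u ∧ G.Adj v w) then p ^ #(tripleSet (u, v, w) \ H) else 0) ≤
      (if G.Adj v u then (1 : ℝ) else 0) * (if G.Adj v w then 1 else 0) *
        ((if u ∈ H then 1 else p) * (if v ∈ H then 1 else p) * (if w ∈ H then 1 else p)) +
      (if u = w then (if G.Adj v u then 1 else 0) *
        ((if u ∈ H then 1 else p) * (if v ∈ H then 1 else p)) else 0) := by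
  have hg : ∀ x, 0 ≤ (if x ∈ H then 1 else p) := fun x => by split_ifs <;> linarith
  by_cases h : G.Adj v u ∧ G.Adj v w
  · rw [if_pos h, if_pos h.1, if_pos h.2, pow_card_sdiff_eq_prod]
    have huv : u ≠ v := h.1.ne'
    have hvw : v ≠ w := h.2.ne
    by_cases huw : u = w
    · subst huw
      rw [if_pos rfl]
      have : tripleSet (u, v, u) = {u, v} := by
        ext x; simp [tripleSet]; tauto
      rw [this, prod_pair huv]
      have := mul_nonneg (mul_nonneg (hg u) (hg v)) (hg u)
      linarith
    · rw [if_neg huw, tripleSet, prod_insert (by simp [huv, huw]), prod_pair hvw]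
      linarith
  · rw [if_neg h]
    have := hg u
    have := hg v
    have := hg w
    positivity

end Cherries

section DegreeSquares

variable {V : Type*} [Fintype V] [DecidableEq V] {G : SimpleGraph V} [DecidableRel G.Adj]

omit [DecidableEq V] in
lemma sum_adj_eq {d : ℕ} (hreg : G.IsRegularOfDegree d) (x : V) :
    ∑ y, (if G.Adj x y then (1 : ℝ) else 0) = d := by
  have := degIn_univ (G := G) x
  rw [hreg x, degIn] at this
  rw [sum_boole, this]

lemma sum_adj_mul_le {d : ℕ} {p c : ℝ} (hreg : G.IsRegularOfDegree d) (h0 : 0 ≤ p)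
    (hp : p * d ≤ c) (H : Finset V) (x : V) :
    ∑ y, (if G.Adj x y then (1 : ℝ) else 0) * (if y ∈ H then 1 else p) ≤ #H + c := by
  have hle : ∀ y ∈ univ, (if G.Adj x y then (1 : ℝ) else 0) * (if y ∈ H then 1 else p) ≤
      (if y ∈ H then 1 else 0) + p * (if G.Adj x y then 1 else 0) := by
    intro y _
    split_ifs <;> simp [h0]
  refine (sum_le_sum hle).trans ?_
  rw [sum_add_distrib, ← mul_sum]
  rw [sum_adj_eq hreg]
  simp only [sum_boole, filter_mem_eq_inter, univ_inter]
  linarith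

lemma sum_cherries_meeting_le {d : ℕ} {p : ℝ} (hreg : G.IsRegularOfDegree d) (h0 : 0 ≤ p)
    (hp : p * d ≤ 2) {H : Finset V} (hH : #H ≤ 3) :
    ∑ t ∈ cherries G with ¬ Disjoint H (tripleSet t), p ^ #(tripleSet t \ H) ≤ 255 := by
  set g : V → ℝ := fun x => if x ∈ H then 1 else p with hg
  set h : V → ℝ := fun x => if x ∈ H then 1 else 0 with hh
  set A : V → V → ℝ := fun x y => if G.Adj x y then 1 else 0 with hA
  have hg0 : ∀ x, 0 ≤ g x := fun x => by simp only [hg]; split_ifs <;> linarith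
  have hh0 : ∀ x, 0 ≤ h x := fun x => by simp only [hh]; split_ifs <;> norm_num
  have hA0 : ∀ x y, 0 ≤ A x y := fun x y => by simp only [hA]; split_ifs <;> norm_num
  have hsymm : ∀ x y, A x y = A y x := fun x y => by simp only [hA, G.adj_comm]
  have hH' : (#H : ℝ) ≤ 3 := by exact_mod_cast hH
  have hstep : ∀ x, ∑ y, A x y * g y ≤ 5 := fun x =>
    (sum_adj_mul_le hreg h0 hp H x).trans (by linarith)
  have hstep0 : ∀ x, 0 ≤ ∑ y, A x y * g y := fun x =>
    sum_nonneg fun y _ => mul_nonneg (hA0 _ _) (hg0 _)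
  have hhg : ∑ x, h x * g x ≤ 3 := by
    have : ∀ x ∈ univ, h x * g x = h x := fun x _ => by
      simp only [hh, hg]; split_ifs <;> simp
    rw [sum_congr rfl this]
    simpa [hh] using hH
  have htwo : ∀ x, ∑ y, A x y * g y * ∑ z, A y z * g z ≤ 25 := by
    intro x
    calc ∑ y, A x y * g y * ∑ z, A y z * g z ≤ ∑ y, A x y * g y * 5 :=
          sum_le_sum fun y _ => mul_le_mul_of_nonneg_left (hstep y)
            (mul_nonneg (hA0 _ _) (hg0 _))
      _ = (∑ y, A x y * g y) * 5 := by rw [sum_mul]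
      _ ≤ 25 := by linarith [hstep x]
  have hpt : ∀ u v w, (if (G.Adj v u ∧ G.Adj v w) ∧ ¬ Disjoint H (tripleSet (u, v, w)) then
      p ^ #(tripleSet (u, v, w) \ H) else 0) ≤
      (h u * g u * (A u v * g v * (A v w * g w)) + h v * g v * ((A v u * g u) * (A v w * g w)) +
        h w * g w * (A w v * g v * (A v u * g u))) +
      (if u = w then h u * g u * (A u v * g v) + h v * g v * (A v u * g u) else 0) := by
    intro u v w
    have hr0 : 0 ≤ (h u * g u * (A u v * g v * (A v w * g w)) +
        h v * g v * ((A v u * g u) * (A v w * g w)) +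
        h w * g w * (A w v * g v * (A v u * g u))) +
        (if u = w then h u * g u * (A u v * g v) + h v * g v * (A v u * g u) else 0) := by
      have := hg0 u
      have := hg0 v
      have := hg0 w
      have := hh0 u
      have := hh0 v
      have := hh0 w
      have := hA0 u v
      have := hA0 v u
      have := hA0 v w
      have := hA0 w v
      split_ifs <;> positivity
    by_cases hd : ¬ Disjoint H (tripleSet (u, v, w))
    · have hx : ∃ x ∈ H, x ∈ tripleSet (u, v, w) := not_disjoint_iff.1 hd
      have hsum : 1 ≤ h u + h v + h w := by
        obtain ⟨x, hxH, hx⟩ := hx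
        have hx1 : h x = 1 := if_pos hxH
        simp only [tripleSet, mem_insert, mem_singleton] at hx
        rcases hx with rfl | rfl | rfl
        · linarith [hh0 v, hh0 w]
        · linarith [hh0 u, hh0 w]
        · linarith [hh0 v, hh0 u]
      simp only [hd, not_false_eq_true, and_true]
      refine (pow_card_tripleSet_sdiff_le h0 H u v w).trans ?_
      change A v u * A v w * (g u * g v * g w) + (if u = w then A v u * (g u * g v) else 0) ≤ _
      have hsq : 0 ≤ A v u * A v w * (g u * g v * g w) :=
        mul_nonneg (mul_nonneg (hA0 _ _) (hA0 _ _))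
          (mul_nonneg (mul_nonneg (hg0 _) (hg0 _)) (hg0 _))
      rw [hsymm u v, hsymm w v]
      have hfirst := mul_le_mul_of_nonneg_right hsum hsq
      refine add_le_add (by linarith) ?_
      split_ifs with huw
      · subst huw
        have hsum2 : 1 ≤ h u + h v := by
          obtain ⟨x, hxH, hx⟩ := hx
          have hx1 : h x = 1 := if_pos hxH
          simp only [tripleSet, mem_insert, mem_singleton] at hx
          rcases hx with rfl | rfl | rfl
          · linarith [hh0 v]
          · linarith [hh0 u]
          · linarith [hh0 v]
        have hsq2 : 0 ≤ A v u * (g u * g v) :=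
          mul_nonneg (hA0 _ _) (mul_nonneg (hg0 _) (hg0 _))
        nlinarith [mul_le_mul_of_nonneg_right hsum2 hsq2]
      · exact le_rfl
    · rw [if_neg fun h => hd h.2]
      exact hr0
  rw [cherries, filter_filter, sum_filter, Fintype.sum_prod_type]
  simp_rw [Fintype.sum_prod_type]
  refine (sum_le_sum fun u _ => sum_le_sum fun v _ => sum_le_sum fun w _ => hpt u v w).trans ?_
  simp only [sum_add_distrib, sum_ite_eq, mem_univ, if_true]
  have e1 : ∑ u, ∑ v, ∑ w, h u * g u * (A u v * g v * (A v w * g w)) ≤ 75 := by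
    calc _ = ∑ u, h u * g u * ∑ v, A u v * g v * ∑ w, A v w * g w := by
          simp only [mul_sum]
      _ ≤ ∑ u, h u * g u * 25 := sum_le_sum fun u _ =>
          mul_le_mul_of_nonneg_left (htwo u) (mul_nonneg (hh0 _) (hg0 _))
      _ ≤ 75 := by rw [← sum_mul]; linarith
  have e2 : ∑ u, ∑ v, ∑ w, h v * g v * ((A v u * g u) * (A v w * g w)) ≤ 75 := by
    calc _ = ∑ v, h v * g v * ((∑ u, A v u * g u) * ∑ w, A v w * g w) := by
          rw [sum_comm]
          refine sum_congr rfl fun v _ => ?_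
          rw [sum_mul_sum]
          simp only [mul_sum]
      _ ≤ ∑ v, h v * g v * 25 := sum_le_sum fun v _ =>
          mul_le_mul_of_nonneg_left (by nlinarith [hstep v, hstep0 v])
            (mul_nonneg (hh0 _) (hg0 _))
      _ ≤ 75 := by rw [← sum_mul]; linarith
  have e3 : ∑ u, ∑ v, ∑ w, h w * g w * (A w v * g v * (A v u * g u)) ≤ 75 := by
    refine le_trans (le_of_eq ?_) e1
    calc _ = ∑ v, ∑ u, ∑ w, h w * g w * (A w v * g v * (A v u * g u)) := sum_comm
      _ = ∑ v, ∑ w, ∑ u, h w * g w * (A w v * g v * (A v u * g u)) :=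
          sum_congr rfl fun _ _ => sum_comm
      _ = _ := sum_comm
  have e4 : ∑ u, ∑ v, h u * g u * (A u v * g v) ≤ 15 := by
    calc _ = ∑ u, h u * g u * ∑ v, A u v * g v := by simp only [mul_sum]
      _ ≤ ∑ u, h u * g u * 5 := sum_le_sum fun u _ =>
          mul_le_mul_of_nonneg_left (hstep u) (mul_nonneg (hh0 _) (hg0 _))
      _ ≤ 15 := by rw [← sum_mul]; linarith
  have e5 : ∑ u, ∑ v, h v * g v * (A v u * g u) ≤ 15 := by
    rw [sum_comm]; exact e4
  linarith

lemma sum_cherries_le {d : ℕ} {p : ℝ} (hreg : G.IsRegularOfDegree d) (h0 : 0 ≤ p)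
    (hp : p * d ≤ 2) :
    ∑ t ∈ cherries G, p ^ #(tripleSet t) ≤ 6 * (p * Fintype.card V) := by
  rw [cherries, sum_filter, Fintype.sum_prod_type]
  simp_rw [Fintype.sum_prod_type]
  have hpt := fun u v w => pow_card_tripleSet_sdiff_le (G := G) h0 ∅ u v w
  simp only [sdiff_empty, notMem_empty, if_false] at hpt
  refine (sum_le_sum fun u _ => sum_le_sum fun v _ => sum_le_sum fun w _ => hpt u v w).trans ?_
  simp only [sum_add_distrib, sum_ite_eq, mem_univ, if_true]
  rw [sum_comm (f := fun u v => (if G.Adj v u then (1 : ℝ) else 0) * (p * p)), sum_comm]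
  simp only [← sum_mul, ← mul_sum, sum_adj_eq hreg, sum_const, card_univ, nsmul_eq_mul]
  have hpd : 0 ≤ p * d := by positivity
  have : 0 ≤ p * Fintype.card V := by positivity
  nlinarith [mul_le_mul_of_nonneg_right (by nlinarith : (p * d) ^ 2 + p * d ≤ 6) this]

lemma prob_sum_degIn_sq_ge_le {d : ℕ} {p N : ℝ} (hreg : G.IsRegularOfDegree d) (h0 : 0 ≤ p)
    (h1 : p ≤ 1) (hp : p * d ≤ 2) (hN : 0 < N) (hpN : p * Fintype.card V ≤ 2 * N) :
    prob p (fun P => 25 * N ≤ ∑ v ∈ P, (degIn G P v : ℝ) ^ 2) ≤ 20 / N := by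
  have := prob_add_le_sum_ind_le (B := 255) (M := 12 * N) (a := 13 * N) h0 h1 (cherries G)
    tripleSet (by norm_num)
    (fun t _ => sum_cherries_meeting_le hreg h0 hp (card_tripleSet_le t))
    ((sum_cherries_le hreg h0 hp).trans (by linarith)) (by positivity)
  simp only [sum_ind_tripleSet] at this
  rw [show 12 * N + 13 * N = 25 * N by ring] at this
  refine this.trans ?_
  rw [div_le_div_iff₀ (by positivity) hN]
  nlinarith [pow_pos hN 2]

end DegreeSquares

section Components

variable {V : Type*} [Fintype V] [DecidableEq V] {G : SimpleGraph V} [DecidableRel G.Adj]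
  {P : Finset V}

open Classical in
/-- The vertices of a component of `G[P]`, as a subset of `V`. -/
noncomputable def compVerts (C : (G.induce (P : Set V)).ConnectedComponent) : Finset V :=
  {v | ∃ h : v ∈ (P : Set V), (G.induce (P : Set V)).connectedComponentMk ⟨v, h⟩ = C}

omit [DecidableRel G.Adj] in
lemma mem_compVerts {C : (G.induce (P : Set V)).ConnectedComponent} {v : V} :
    v ∈ compVerts C ↔
      ∃ h : v ∈ (P : Set V), (G.induce (P : Set V)).connectedComponentMk ⟨v, h⟩ = C := by
  simp [compVerts]

omit [DecidableRel G.Adj] in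
lemma compVerts_subset (C : (G.induce (P : Set V)).ConnectedComponent) : compVerts C ⊆ P :=
  fun _ hv => (mem_compVerts.1 hv).1

omit [DecidableRel G.Adj] in
lemma card_compVerts (C : (G.induce (P : Set V)).ConnectedComponent) :
    #(compVerts C) = C.supp.ncard := by
  rw [← Set.ncard_image_of_injective _ Subtype.val_injective, ← Set.ncard_coe_finset]
  congr 1
  ext v
  simp [mem_compVerts]

omit [DecidableRel G.Adj] in
lemma mem_compVerts_of_adj {C : (G.induce (P : Set V)).ConnectedComponent} {u v : V}
    (hv : v ∈ compVerts C) (hu : u ∈ P) (hvu : G.Adj v u) : u ∈ compVerts C := by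
  obtain ⟨h, rfl⟩ := mem_compVerts.1 hv
  refine mem_compVerts.2 ⟨hu, ?_⟩
  rw [SimpleGraph.ConnectedComponent.eq]
  exact SimpleGraph.Adj.reachable (G := G.induce (P : Set V)) (u := ⟨u, hu⟩) (v := ⟨v, h⟩) hvu.symm

omit [DecidableRel G.Adj] in
lemma eq_of_mem_compVerts {C D : (G.induce (P : Set V)).ConnectedComponent} {v : V}
    (hC : v ∈ compVerts C) (hD : v ∈ compVerts D) : C = D := by
  obtain ⟨h, rfl⟩ := mem_compVerts.1 hC
  exact (mem_compVerts.1 hD).2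

omit [DecidableRel G.Adj] in
lemma disjoint_compVerts {C D : (G.induce (P : Set V)).ConnectedComponent} (h : C ≠ D) :
    Disjoint (compVerts C) (compVerts D) :=
  disjoint_left.2 fun _ hC hD => h (eq_of_mem_compVerts hC hD)

/-- The vertices of a family of components of `G[P]`. -/
noncomputable def unionVerts (𝒞 : Finset (G.induce (P : Set V)).ConnectedComponent) : Finset V :=
  𝒞.biUnion compVerts

variable {𝒞 𝒟 : Finset (G.induce (P : Set V)).ConnectedComponent}

omit [DecidableRel G.Adj] in
lemma unionVerts_subset : unionVerts 𝒞 ⊆ P := biUnion_subset.2 fun C _ => compVerts_subset C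

omit [DecidableRel G.Adj] in
lemma card_unionVerts : #(unionVerts 𝒞) = ∑ C ∈ 𝒞, #(compVerts C) :=
  card_biUnion fun _ _ _ _ h => disjoint_compVerts h

omit [DecidableRel G.Adj] in
lemma mem_unionVerts_of_adj {u v : V} (hv : v ∈ unionVerts 𝒞) (hu : u ∈ P) (hvu : G.Adj v u) :
    u ∈ unionVerts 𝒞 := by
  obtain ⟨C, hC, hv⟩ := mem_biUnion.1 hv
  exact mem_biUnion.2 ⟨C, hC, mem_compVerts_of_adj hv hu hvu⟩

omit [DecidableRel G.Adj] in
lemma disjoint_unionVerts (h : Disjoint 𝒞 𝒟) : Disjoint (unionVerts 𝒞) (unionVerts 𝒟) := by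
  refine disjoint_left.2 fun v hC hD => ?_
  obtain ⟨C, hC, hv⟩ := mem_biUnion.1 hC
  obtain ⟨D, hD, hv'⟩ := mem_biUnion.1 hD
  exact disjoint_left.1 h hC (eq_of_mem_compVerts hv hv' ▸ hD)

lemma disjoint_bdry_unionVerts : Disjoint P (bdry G (unionVerts 𝒞)) := by
  refine disjoint_left.2 fun v hv hb => ?_
  obtain ⟨hn, hnot⟩ := mem_sdiff.1 hb
  obtain ⟨s, hs, hsv⟩ := mem_nbhd.1 hn
  exact hnot (mem_unionVerts_of_adj hs hv hsv)

omit [DecidableRel G.Adj] in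
lemma mem_of_walk {C : (G.induce (P : Set V)).ConnectedComponent} {Z : Finset V}
    (hZ : ∀ x ∈ Z, ∀ y ∈ compVerts C, G.Adj x y → y ∈ Z) {x y : (P : Set V)}
    (w : (G.induce (P : Set V)).Walk x y) (hx : (x : V) ∈ compVerts C) (hxZ : (x : V) ∈ Z) :
    (y : V) ∈ Z := by
  induction w with
  | nil => exact hxZ
  | @cons x z y h _ ih =>
    have hz : (z : V) ∈ compVerts C := mem_compVerts_of_adj hx z.2 h
    exact ih hz (hZ _ hxZ _ hz h)

omit [DecidableRel G.Adj] in
lemma exists_rooted {κ : ℝ} (hκ : ∀ C ∈ 𝒞, κ ≤ #(compVerts C)) (h0 : 0 ≤ κ) :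
    ∃ R, Rooted G R (unionVerts 𝒞) ∧ κ * #R ≤ #(unionVerts 𝒞) := by
  classical
  have hroot : ∀ C : (G.induce (P : Set V)).ConnectedComponent, ∃ r, r ∈ compVerts C := by
    intro C
    obtain ⟨r, hr⟩ := C.exists_rep
    exact ⟨r, mem_compVerts.2 ⟨r.2, hr⟩⟩
  choose r hr using hroot
  refine ⟨𝒞.image r, ⟨?_, ?_⟩, ?_⟩
  · intro v hv
    obtain ⟨C, hC, rfl⟩ := mem_image.1 hv
    exact mem_biUnion.2 ⟨C, hC, hr C⟩
  · intro Z hR hZ v hv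
    obtain ⟨C, hC, hv⟩ := mem_biUnion.1 hv
    obtain ⟨h1, h2⟩ := mem_compVerts.1 (hr C)
    obtain ⟨h3, h4⟩ := mem_compVerts.1 hv
    obtain ⟨w⟩ := SimpleGraph.ConnectedComponent.exact (h2.trans h4.symm)
    exact mem_of_walk (C := C) (fun x hx y hy => hZ x hx y (mem_biUnion.2 ⟨C, hC, hy⟩)) w (hr C)
      (hR (mem_image_of_mem r hC))
  · calc κ * #(𝒞.image r) ≤ κ * #𝒞 := by gcongr; exact card_image_le
      _ = ∑ C ∈ 𝒞, κ := by rw [sum_const, nsmul_eq_mul]; ring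
      _ ≤ ∑ C ∈ 𝒞, (#(compVerts C) : ℝ) := sum_le_sum hκ
      _ = _ := by rw [card_unionVerts]; push_cast; rfl

lemma card_bdry_add (h : Disjoint 𝒞 𝒟) [DecidableEq (G.induce (P : Set V)).ConnectedComponent] :
    #(bdry G (unionVerts 𝒞)) + #(bdry G (unionVerts 𝒟)) =
      #(bdry G (unionVerts (𝒞 ∪ 𝒟))) +
        #(nbhd G (unionVerts 𝒟) ∩ nbhd G (unionVerts 𝒞)) := by
  have hU : unionVerts (𝒞 ∪ 𝒟) = unionVerts 𝒞 ∪ unionVerts 𝒟 := by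
    ext v
    simp only [unionVerts, mem_biUnion, mem_union, or_and_right, exists_or]
  have hnot : ∀ {ℰ : Finset (G.induce (P : Set V)).ConnectedComponent} {v},
      v ∈ bdry G (unionVerts ℰ) → v ∉ P := fun hv hP =>
    disjoint_left.1 disjoint_bdry_unionVerts hP hv
  rw [← card_union_add_card_inter]
  congr 2
  · rw [hU]
    ext v
    constructor
    · intro hv
      have hvP : v ∉ P := by
        rcases mem_union.1 hv with hv | hv <;> exact hnot hv
      refine mem_sdiff.2 ⟨?_, fun h => hvP (union_subset unionVerts_subset unionVerts_subset h)⟩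
      rw [nbhd_union]
      rcases mem_union.1 hv with hv | hv
      · exact mem_union_left _ (mem_sdiff.1 hv).1
      · exact mem_union_right _ (mem_sdiff.1 hv).1
    · intro hv
      obtain ⟨h1, h2⟩ := mem_sdiff.1 hv
      rw [nbhd_union] at h1
      rw [mem_union, not_or] at h2
      rcases mem_union.1 h1 with h1 | h1
      · exact mem_union_left _ (mem_sdiff.2 ⟨h1, h2.1⟩)
      · exact mem_union_right _ (mem_sdiff.2 ⟨h1, h2.2⟩)
  · ext v
    rw [inter_comm, mem_inter, mem_inter]
    constructor
    · rintro ⟨h1, h2⟩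
      exact ⟨(mem_sdiff.1 h1).1, (mem_sdiff.1 h2).1⟩
    · rintro ⟨h1, h2⟩
      have hvP : v ∉ P := by
        intro hvP
        obtain ⟨s, hs, hsv⟩ := mem_nbhd.1 h1
        obtain ⟨t, ht, htv⟩ := mem_nbhd.1 h2
        exact disjoint_left.1 (disjoint_unionVerts h) (mem_unionVerts_of_adj ht hvP htv)
          (mem_unionVerts_of_adj hs hvP hsv)
      exact ⟨mem_sdiff.2 ⟨h1, fun h => hvP (unionVerts_subset h)⟩,
        mem_sdiff.2 ⟨h2, fun h => hvP (unionVerts_subset h)⟩⟩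

lemma degIn_le_card_compVerts {C : (G.induce (P : Set V)).ConnectedComponent} {v : V}
    (hv : v ∈ compVerts C) : degIn G P v ≤ #(compVerts C) :=
  card_le_card fun _ hu => mem_compVerts_of_adj hv (mem_filter.1 hu).1 (mem_filter.1 hu).2

lemma exists_shortCycle {C : (G.induce (P : Set V)).ConnectedComponent} {K : ℕ}
    (hK : #(compVerts C) ≤ K) (hC : ¬ ((G.induce (P : Set V)).induce C.supp).IsTree) :
    ∃ T ∈ shortCycles G K, T.Nonempty ∧ T ⊆ compVerts C := by
  have hconn : ((G.induce (P : Set V)).induce C.supp).Connected := C.connected_toSimpleGraph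
  have hcyc : ¬ ((G.induce (P : Set V)).induce C.supp).IsAcyclic := fun h => hC ⟨hconn, h⟩
  simp only [SimpleGraph.IsAcyclic, not_forall, not_not] at hcyc
  obtain ⟨v, w, hw⟩ := hcyc
  let f : (G.induce (P : Set V)).induce C.supp →g G :=
    (SimpleGraph.Embedding.induce (P : Set V)).toHom.comp
      (SimpleGraph.Embedding.induce C.supp).toHom
  have hf : Function.Injective f :=
    (Subtype.val_injective).comp Subtype.val_injective
  have hsub : (w.map f).support.toFinset ⊆ compVerts C := by
    intro x hx
    rw [List.mem_toFinset, SimpleGraph.Walk.support_map, List.mem_map] at hx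
    obtain ⟨y, -, rfl⟩ := hx
    exact mem_compVerts.2 ⟨y.1.2, y.2⟩
  exact ⟨_, support_mem_shortCycles (hw.map hf) ((card_le_card hsub).trans hK),
    ⟨f v, by simp⟩, hsub⟩

lemma ncard_edges_le (p : (G.induce (P : Set V)).ConnectedComponent → Prop)
    (h𝒞 : ∀ C, p C → C ∈ 𝒞) :
    {e ∈ (G.induce (P : Set V)).edgeSet |
      ∃ v, v ∈ e ∧ p ((G.induce (P : Set V)).connectedComponentMk v)}.ncard ≤
      ∑ C ∈ 𝒞, ∑ v ∈ compVerts C, degIn G P v := by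
  rw [← sum_biUnion fun _ _ _ _ h => disjoint_compVerts h]
  rw [← Set.ncard_image_of_injective _ (Sym2.map.injective Subtype.val_injective)]
  calc _ ≤ #((𝒞.biUnion compVerts).biUnion fun v =>
        {u ∈ P | G.Adj v u}.image fun u => s(v, u)) := by
        rw [← Set.ncard_coe_finset]
        refine Set.ncard_le_ncard ?_ (Finset.finite_toSet _)
        rintro _ ⟨e, ⟨he, v, hv, hp⟩, rfl⟩
        obtain ⟨u, rfl⟩ := Sym2.mem_iff_exists.1 hv
        rw [mem_coe, mem_biUnion]
        refine ⟨v, mem_biUnion.2 ⟨_, h𝒞 _ hp, mem_compVerts.2 ⟨v.2, rfl⟩⟩, ?_⟩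
        exact mem_image.2 ⟨u, mem_filter.2 ⟨u.2, he⟩, rfl⟩
    _ ≤ _ := card_biUnion_le.trans (sum_le_sum fun v _ => card_image_le)

end Components

/-- A weighted family in which the weights other than a largest one are substantial can be split
into two substantial parts. -/
lemma exists_balanced_split {ι : Type*} [DecidableEq ι] (s : Finset ι) (w : ι → ℝ)
    (hw : ∀ i ∈ s, 0 ≤ w i) {i₀ : ι} (hi₀ : i₀ ∈ s) (hmax : ∀ i ∈ s, w i ≤ w i₀) {a : ℝ}
    (ha : 0 ≤ a) (h : 3 * a ≤ ∑ i ∈ s.erase i₀, w i) :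
    ∃ t ⊆ s, a ≤ ∑ i ∈ t, w i ∧ a ≤ ∑ i ∈ s \ t, w i := by
  by_cases hbig : a ≤ w i₀
  · refine ⟨{i₀}, singleton_subset_iff.2 hi₀, by simpa using hbig, ?_⟩
    rw [sdiff_singleton_eq_erase]
    linarith
  push Not at hbig
  have hsum : 3 * a ≤ ∑ i ∈ s, w i := by
    rw [← add_sum_erase s w hi₀]
    linarith [hw i₀ hi₀]
  obtain ⟨t, ht, hmin⟩ := exists_min_image (s.powerset.filter fun t => a ≤ ∑ i ∈ t, w i) card
    ⟨s, mem_filter.2 ⟨mem_powerset_self s, by linarith⟩⟩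
  obtain ⟨hts, hta⟩ := mem_filter.1 ht
  rw [mem_powerset] at hts
  refine ⟨t, hts, hta, ?_⟩
  have hlt : ∑ i ∈ t, w i ≤ 2 * a := by
    rcases t.eq_empty_or_nonempty with rfl | ⟨i, hi⟩
    · simpa using ha
    · by_contra! hlt
      have := hmin (t.erase i) (mem_filter.2 ⟨mem_powerset.2 ((erase_subset _ _).trans hts), ?_⟩)
      · exact absurd this (not_le.2 (card_erase_lt_of_mem hi))
      · rw [← add_sum_erase t w hi] at hlt
        linarith [hmax i (hts hi)]
  have := sum_sdiff (f := w) hts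
  linarith

section Deterministic

variable {V : Type*} [Fintype V] [DecidableEq V] {G : SimpleGraph V} [DecidableRel G.Adj]
  {P : Finset V}

lemma card_lt_of_no_disjoint_family {K : ℕ} {m : ℝ}
    (hcyc : ∀ 𝓕 ⊆ shortCycles G K, (𝓕 : Set (Finset V)).PairwiseDisjoint id →
      (∀ T ∈ 𝓕, T ⊆ P) → #𝓕 < m)
    (𝒞 : Finset (G.induce (P : Set V)).ConnectedComponent)
    (h𝒞 : ∀ C ∈ 𝒞, #(compVerts C) ≤ K ∧ ¬ ((G.induce (P : Set V)).induce C.supp).IsTree) :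
    #𝒞 < m := by
  classical
  have : ∀ C ∈ 𝒞, ∃ T ∈ shortCycles G K, T.Nonempty ∧ T ⊆ compVerts C := fun C hC =>
    exists_shortCycle (h𝒞 C hC).1 (h𝒞 C hC).2
  choose! T hT hne hsub using this
  have hinj : Set.InjOn T 𝒞 := by
    intro C hC D hD h
    obtain ⟨x, hx⟩ := hne C hC
    exact eq_of_mem_compVerts (hsub C hC hx) (hsub D hD (h ▸ hx))
  rw [← card_image_of_injOn hinj]
  refine hcyc _ (image_subset_iff.2 hT) ?_ ?_
  · intro A hA B hB hAB
    obtain ⟨C, hC, rfl⟩ := mem_image.1 (mem_coe.1 hA)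
    obtain ⟨D, hD, rfl⟩ := mem_image.1 (mem_coe.1 hB)
    have hCD : C ≠ D := by
      rintro rfl; exact hAB rfl
    exact (disjoint_compVerts hCD).mono (hsub C hC) (hsub D hD)
  · intro A hA
    obtain ⟨C, hC, rfl⟩ := mem_image.1 hA
    exact (hsub C hC).trans (compVerts_subset C)

lemma sum_degIn_small_le {K : ℕ} {m : ℝ}
    (𝒞 : Finset (G.induce (P : Set V)).ConnectedComponent) (h𝒞 : ∀ C ∈ 𝒞, #(compVerts C) ≤ K)
    (hm : #𝒞 ≤ m) : ((∑ C ∈ 𝒞, ∑ v ∈ compVerts C, degIn G P v : ℕ) : ℝ) ≤ m * K ^ 2 := by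
  have : ∑ C ∈ 𝒞, ∑ v ∈ compVerts C, degIn G P v ≤ #𝒞 * K ^ 2 := by
    rw [← smul_eq_mul, ← sum_const]
    refine sum_le_sum fun C hC => ?_
    calc ∑ v ∈ compVerts C, degIn G P v ≤ ∑ v ∈ compVerts C, K :=
          sum_le_sum fun v hv => (degIn_le_card_compVerts hv).trans (h𝒞 C hC)
      _ = #(compVerts C) * K := by rw [sum_const, smul_eq_mul]
      _ ≤ K ^ 2 := by rw [sq]; gcongr; exact h𝒞 C hC
  calc ((∑ C ∈ 𝒞, ∑ v ∈ compVerts C, degIn G P v : ℕ) : ℝ) ≤ ((#𝒞 * K ^ 2 : ℕ) : ℝ) := by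
        exact_mod_cast this
    _ ≤ m * K ^ 2 := by push_cast; gcongr

lemma sum_degIn_le_sqrt (𝒞 : Finset (G.induce (P : Set V)).ConnectedComponent) {a X : ℝ}
    (ha : (∑ C ∈ 𝒞, (#(compVerts C) : ℝ)) ≤ a) (hX : ∑ v ∈ P, (degIn G P v : ℝ) ^ 2 ≤ X) :
    ((∑ C ∈ 𝒞, ∑ v ∈ compVerts C, degIn G P v : ℕ) : ℝ) ≤ √(a * X) := by
  rw [← sum_biUnion fun _ _ _ _ h => disjoint_compVerts h]
  refine Real.le_sqrt_of_sq_le ?_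
  push_cast
  have hcard : (#(unionVerts 𝒞) : ℝ) ≤ a := by
    rw [card_unionVerts]; push_cast; exact ha
  calc (∑ v ∈ unionVerts 𝒞, (degIn G P v : ℝ)) ^ 2
      ≤ #(unionVerts 𝒞) * ∑ v ∈ unionVerts 𝒞, (degIn G P v : ℝ) ^ 2 := sq_sum_le_card_mul_sum_sq
    _ ≤ #(unionVerts 𝒞) * ∑ v ∈ P, (degIn G P v : ℝ) ^ 2 := by
        refine mul_le_mul_of_nonneg_left ?_ (Nat.cast_nonneg _)
        exact sum_le_sum_of_subset_of_nonneg unionVerts_subset fun _ _ _ => sq_nonneg _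
    _ ≤ a * X := mul_le_mul hcard hX (sum_nonneg fun _ _ => sq_nonneg _)
        ((Nat.cast_nonneg _).trans hcard)

end Deterministic

section Deterministic

variable {n d : ℕ} {G : SimpleGraph (Fin n)} [DecidableRel G.Adj] {P : Finset (Fin n)}

/-- In an expanding set whose unions of big components have boundaries of the expected size, all
big components but a largest one are small in total. -/
lemma sum_card_big_lt {a p ς κ : ℝ} (hd : 0 < d) (hn : 0 < n) (ha0 : 0 < a) (ha : a ≤ 1)
    (hexp : Expanding G d (a / 16) (a * (n / d) / 2) P) (hP : (#P : ℝ) ≤ 4 * (n / d))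
    (hp0 : 0 ≤ p) (hpn : n / d ≤ p * n) (hς : 48 * ς ≤ a ^ 2 / 64) (hκ : 0 ≤ κ)
    (hdev : ∀ R S, Rooted G R S → κ * #R ≤ #S → (#S : ℝ) ≤ 4 * (n / d) → S ⊆ P →
      Disjoint P (bdry G S) → |p * #(bdry G S) - #S| < 16 * ς * (n / d))
    (𝒞 : Finset (G.induce (P : Set (Fin n))).ConnectedComponent)
    [DecidableEq (G.induce (P : Set (Fin n))).ConnectedComponent]
    (h𝒞 : ∀ C ∈ 𝒞, κ ≤ #(compVerts C)) {C₀ : (G.induce (P : Set (Fin n))).ConnectedComponent}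
    (hC₀ : C₀ ∈ 𝒞) (hmax : ∀ C ∈ 𝒞, #(compVerts C) ≤ #(compVerts C₀)) :
    ∑ C ∈ 𝒞.erase C₀, (#(compVerts C) : ℝ) < 3 * (a * (n / d)) := by
  by_contra! hlt
  obtain ⟨𝒟, h𝒟, h1, h2⟩ := exists_balanced_split 𝒞 (fun C => (#(compVerts C) : ℝ))
    (fun _ _ => by positivity) hC₀ (fun C hC => by exact_mod_cast hmax C hC) (by positivity) hlt
  have hdisj : Disjoint 𝒟 (𝒞 \ 𝒟) := disjoint_sdiff
  have hbd : ∀ ℰ ⊆ 𝒞, |p * #(bdry G (unionVerts ℰ)) - #(unionVerts ℰ)| < 16 * ς * (n / d) := by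
    intro ℰ hℰ
    obtain ⟨R, hR, hRκ⟩ := exists_rooted (𝒞 := ℰ) (fun C hC => h𝒞 C (hℰ hC)) hκ
    refine hdev R _ hR hRκ (le_trans ?_ hP) unionVerts_subset disjoint_bdry_unionVerts
    exact_mod_cast card_le_card unionVerts_subset
  have hA := abs_lt.1 (hbd 𝒟 h𝒟)
  have hB := abs_lt.1 (hbd (𝒞 \ 𝒟) sdiff_subset)
  have hU := abs_lt.1 (hbd (𝒟 ∪ 𝒞 \ 𝒟) (union_subset h𝒟 sdiff_subset))
  have hcardU : (#(unionVerts (𝒟 ∪ 𝒞 \ 𝒟)) : ℝ) =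
      #(unionVerts 𝒟) + #(unionVerts (𝒞 \ 𝒟)) := by
    rw [card_unionVerts, sum_union hdisj, ← card_unionVerts, ← card_unionVerts]
    push_cast
    rfl
  have hadd : (#(bdry G (unionVerts 𝒟)) : ℝ) + #(bdry G (unionVerts (𝒞 \ 𝒟))) =
      #(bdry G (unionVerts (𝒟 ∪ 𝒞 \ 𝒟))) +
        #(nbhd G (unionVerts (𝒞 \ 𝒟)) ∩ nbhd G (unionVerts 𝒟)) := by
    exact_mod_cast card_bdry_add hdisj
  have hcommon := hexp.card_common_nbhd hd hn ha0 ha (unionVerts_subset (𝒞 := 𝒟))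
    (unionVerts_subset (𝒞 := 𝒞 \ 𝒟)) (disjoint_unionVerts hdisj)
    (by rw [card_unionVerts]; push_cast; exact h1) (by rw [card_unionVerts]; push_cast; exact h2)
  have hpc := mul_le_mul_of_nonneg_left hcommon hp0
  have hlow : a ^ 2 / 64 * (n / d) ≤ a ^ 2 / 64 * (p * n) := by gcongr
  have hN : (0 : ℝ) ≤ n / d := by positivity
  have hς' := mul_le_mul_of_nonneg_right hς hN
  have hadd' := congrArg (p * ·) hadd
  simp only [mul_add] at hadd'
  linarith [hA.2, hB.2, hU.1]

/-- The deterministic part of the argument. -/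
lemma ncard_edges_outside_le {a p ς m : ℝ} {K : ℕ} (hd : 0 < d) (hn : 0 < n) (ha0 : 0 < a)
    (ha : a ≤ 1) (hexp : Expanding G d (a / 16) (a * (n / d) / 2) P)
    (hP : (#P : ℝ) ≤ 4 * (n / d)) (hp0 : 0 ≤ p) (hpn : n / d ≤ p * n)
    (hς : 48 * ς ≤ a ^ 2 / 64)
    (hdev : ∀ R S, Rooted G R S → (K : ℝ) * #R ≤ #S → (#S : ℝ) ≤ 4 * (n / d) → S ⊆ P →
      Disjoint P (bdry G S) → |p * #(bdry G S) - #S| < 16 * ς * (n / d))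
    (hcyc : ∀ 𝓕 ⊆ shortCycles G K, (𝓕 : Set (Finset (Fin n))).PairwiseDisjoint id →
      (∀ T ∈ 𝓕, T ⊆ P) → #𝓕 < m) (hmK : m * K ^ 2 ≤ a * (n / d))
    (hX : ∑ v ∈ P, (degIn G P v : ℝ) ^ 2 ≤ 25 * (n / d)) :
    ({e ∈ (G.induce (P : Set (Fin n))).edgeSet | ∃ v, v ∈ e ∧
      (∃ C' : (G.induce (P : Set (Fin n))).ConnectedComponent,
        ((G.induce (P : Set (Fin n))).connectedComponentMk v).supp.ncard < C'.supp.ncard) ∧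
      ¬ ((G.induce (P : Set (Fin n))).induce
        ((G.induce (P : Set (Fin n))).connectedComponentMk v).supp).IsTree}.ncard : ℝ) ≤
      a * (n / d) + √(3 * (a * (n / d)) * (25 * (n / d))) := by
  classical
  let H := G.induce (P : Set (Fin n))
  let bad : H.ConnectedComponent → Prop := fun C =>
    (∃ C' : H.ConnectedComponent, C.supp.ncard < C'.supp.ncard) ∧ ¬ (H.induce C.supp).IsTree
  let 𝒞₁ : Finset H.ConnectedComponent := {C | bad C ∧ #(compVerts C) ≤ K}
  let 𝒞₂ : Finset H.ConnectedComponent := {C | bad C ∧ ¬ #(compVerts C) ≤ K}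
  have hdisj : Disjoint 𝒞₁ 𝒞₂ := disjoint_left.2 fun C h1 h2 =>
    (mem_filter.1 h2).2.2 (mem_filter.1 h1).2.2
  have hedges := ncard_edges_le (G := G) (P := P) (𝒞 := 𝒞₁ ∪ 𝒞₂) bad fun C hC => by
    by_cases h : #(compVerts C) ≤ K
    · exact mem_union_left _ (mem_filter.2 ⟨mem_univ _, hC, h⟩)
    · exact mem_union_right _ (mem_filter.2 ⟨mem_univ _, hC, h⟩)
  rw [sum_union hdisj] at hedges
  have h1 : ((∑ C ∈ 𝒞₁, ∑ v ∈ compVerts C, degIn G P v : ℕ) : ℝ) ≤ a * (n / d) := by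
    refine (sum_degIn_small_le 𝒞₁ (fun C hC => (mem_filter.1 hC).2.2) ?_).trans hmK
    exact (card_lt_of_no_disjoint_family hcyc 𝒞₁ fun C hC =>
      ⟨(mem_filter.1 hC).2.2, (mem_filter.1 hC).2.1.2⟩).le
  have h2 : ((∑ C ∈ 𝒞₂, ∑ v ∈ compVerts C, degIn G P v : ℕ) : ℝ) ≤
      √(3 * (a * (n / d)) * (25 * (n / d))) := by
    refine sum_degIn_le_sqrt 𝒞₂ ?_ hX
    rcases 𝒞₂.eq_empty_or_nonempty with he | ⟨C₁, hC₁⟩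
    · rw [he, sum_empty]; positivity
    obtain ⟨C₀, -, hC₀⟩ := exists_max_image (univ : Finset H.ConnectedComponent)
      (fun C => #(compVerts C)) ⟨C₁, mem_univ _⟩
    let ℬ : Finset H.ConnectedComponent := {C | ¬ #(compVerts C) ≤ K}
    have hC₀ℬ : C₀ ∈ ℬ := mem_filter.2 ⟨mem_univ _, fun h =>
      (mem_filter.1 hC₁).2.2 ((hC₀ C₁ (mem_univ _)).trans h)⟩
    have hsub : 𝒞₂ ⊆ ℬ.erase C₀ := by
      intro C hC
      obtain ⟨⟨⟨C', hC'⟩, -⟩, hK⟩ := (mem_filter.1 hC).2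
      refine mem_erase.2 ⟨?_, mem_filter.2 ⟨mem_univ _, hK⟩⟩
      rintro rfl
      rw [← card_compVerts, ← card_compVerts] at hC'
      exact absurd (hC₀ C' (mem_univ _)) (not_le.2 hC')
    refine (sum_le_sum_of_subset_of_nonneg hsub fun _ _ _ => by positivity).trans ?_
    refine (sum_card_big_lt hd hn ha0 ha hexp hP hp0 hpn hς (Nat.cast_nonneg K) hdev ℬ ?_ hC₀ℬ
      fun C _ => hC₀ C (mem_univ _)).le
    intro C hC
    exact_mod_cast (not_le.1 (mem_filter.1 hC).2).le
  calc _ ≤ ((∑ C ∈ 𝒞₁, ∑ v ∈ compVerts C, degIn G P v +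
        ∑ C ∈ 𝒞₂, ∑ v ∈ compVerts C, degIn G P v : ℕ) : ℝ) := by exact_mod_cast hedges
    _ ≤ _ := by push_cast at h1 h2 ⊢; exact add_le_add h1 h2

end Deterministic

section Measure

open MeasureTheory

lemma bernoulliMeasure_singleton {p : ℝ} (b : Bool) :
    bernoulliMeasure p {b} = ENNReal.ofReal (if b then p else 1 - p) := by
  cases b <;> simp [bernoulliMeasure]

instance isFiniteMeasure_bernoulliMeasure (p : ℝ) : IsFiniteMeasure (bernoulliMeasure p) := by
  refine ⟨?_⟩
  simp only [bernoulliMeasure, Measure.coe_add, Measure.coe_smul, Pi.add_apply, Pi.smul_apply,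
    measure_univ, smul_eq_mul, mul_one]
  exact ENNReal.add_lt_top.2 ⟨ENNReal.ofReal_lt_top, ENNReal.ofReal_lt_top⟩

variable {V : Type*} [Fintype V] [DecidableEq V]

/-- Outcomes of percolation as finite sets. -/
def outcomeEquiv : (V → Bool) ≃ Finset V where
  toFun ω := {v | ω v = true}
  invFun P v := decide (v ∈ P)
  left_inv ω := by ext v; simp
  right_inv P := by ext v; simp

omit [DecidableEq V] in
lemma percolationMeasure_singleton {p : ℝ} (h0 : 0 ≤ p) (h1 : p ≤ 1) (ω : V → Bool) :
    percolationMeasure V p {ω} = ENNReal.ofReal (∏ v, if ω v then p else 1 - p) := by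
  rw [percolationMeasure, Measure.pi_singleton,
    ENNReal.ofReal_prod_of_nonneg fun v _ => by split_ifs <;> linarith]
  exact prod_congr rfl fun v _ => bernoulliMeasure_singleton _

lemma prod_outcome (p : ℝ) (ω : V → Bool) :
    (∏ v, if ω v then p else 1 - p) =
      p ^ #(outcomeEquiv ω) * (1 - p) ^ #(outcomeEquiv ω)ᶜ := by
  rw [prod_ite, prod_const, prod_const]
  congr 3
  ext v
  simp [outcomeEquiv]

/-- A lower bound for the percolation measure of a set of outcomes in terms of the probability of
an exceptional event. -/
lemma ofReal_one_sub_prob_le {p : ℝ} (h0 : 0 ≤ p) (h1 : p ≤ 1) (E : Finset V → Prop)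
    (S : Set (V → Bool)) (hS : ∀ ω, ¬ E (outcomeEquiv ω) → ω ∈ S) :
    ENNReal.ofReal (1 - prob p E) ≤ percolationMeasure V p S := by
  classical
  have hw : ∀ ω : V → Bool, 0 ≤ ∏ v, if ω v then p else 1 - p := fun ω =>
    prod_nonneg fun v _ => by split_ifs <;> linarith
  have hsum : 1 - prob p E =
      ∑ ω : V → Bool with ¬ E (outcomeEquiv ω), ∏ v, if ω v then p else 1 - p := by
    have h : 1 - prob p E = expect p (fun P => 1 + (-1) * ind (E P)) := by
      rw [expect_add, expect_one, expect_mul, prob]; ring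
    rw [h, expect, ← outcomeEquiv.sum_comp, sum_filter]
    refine sum_congr rfl fun ω _ => ?_
    rw [prod_outcome]
    by_cases hE : E (outcomeEquiv ω)
    · rw [ind_true hE, if_neg (not_not.2 hE)]; ring
    · rw [ind_false hE, if_pos hE]; ring
  calc ENNReal.ofReal (1 - prob p E)
      = ∑ ω : V → Bool with ¬ E (outcomeEquiv ω), percolationMeasure V p {ω} := by
        rw [hsum, ENNReal.ofReal_sum_of_nonneg fun ω _ => hw ω]
        exact sum_congr rfl fun ω _ => (percolationMeasure_singleton h0 h1 ω).symm
    _ = percolationMeasure V p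
          ((univ.filter fun ω : V → Bool => ¬ E (outcomeEquiv ω) : Finset _) : Set _) :=
        sum_measure_singleton
    _ ≤ percolationMeasure V p S := measure_mono fun ω hω => hS ω (mem_filter.1 hω).2

lemma percSet_eq (ω : V → Bool) : percSet ω = (outcomeEquiv ω : Set V) := by
  ext v
  simp [percSet, outcomeEquiv]

end Measure

section Main

lemma exp_neg_le_one_div {x : ℝ} (hx : 0 < x) : Real.exp (-x) ≤ 1 / x := by
  rw [Real.exp_neg, inv_eq_one_div]
  exact one_div_le_one_div_of_le hx (by linarith [Real.add_one_le_exp x])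

lemma exp_neg_mul_le {x y N : ℝ} (hy : 0 < y) (hN : 0 < N) (h : x ≤ -(y * N)) :
    Real.exp x ≤ 1 / y / N :=
  (Real.exp_le_exp.2 h).trans ((exp_neg_le_one_div (by positivity)).trans
    (by rw [div_div]))

variable {n d : ℕ} {G : SimpleGraph (Fin n)} [DecidableRel G.Adj]

/-- The number of edges in components of `G[P]` which are neither trees nor of largest order. -/
noncomputable def edgesOutside (G : SimpleGraph (Fin n)) (P : Finset (Fin n)) : ℕ :=
  {e ∈ (G.induce (P : Set (Fin n))).edgeSet | ∃ v, v ∈ e ∧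
      (∃ C' : (G.induce (P : Set (Fin n))).ConnectedComponent,
        ((G.induce (P : Set (Fin n))).connectedComponentMk v).supp.ncard < C'.supp.ncard) ∧
      ¬ ((G.induce (P : Set (Fin n))).induce
        ((G.induce (P : Set (Fin n))).connectedComponentMk v).supp).IsTree}.ncard

lemma prob_not_expanding_le_one_div {a c eta : ℝ} (hG : Pseudorandom G d eta) (hd : 0 < d)
    (hn : 0 < n) (ha0 : 0 < a) (hc0 : 0 ≤ c) (hc : c ≤ 2) (hcd : c / d ≤ 1) (heta0 : 0 ≤ eta)
    (heta : eta ≤ Real.exp (-(160 / a))) :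
    prob (c / d) (fun P => ¬ Expanding G d (a / 16) (a * (n / d) / 2) P) ≤ 1 / (n / d) := by
  have hN : (0 : ℝ) < n / d := by positivity
  have hexp : Real.exp (256 / a) * (4 * eta ^ 2 / (a / 16)) ≤ 1 := by
    have h1 : eta ^ 2 ≤ Real.exp (-(320 / a)) := by
      calc eta ^ 2 ≤ Real.exp (-(160 / a)) ^ 2 := by gcongr
        _ = _ := by rw [← Real.exp_nat_mul]; congr 1; push_cast; ring
    have h2 : 64 / a ≤ Real.exp (64 / a) := by linarith [Real.add_one_le_exp (64 / a)]
    calc Real.exp (256 / a) * (4 * eta ^ 2 / (a / 16))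
        = Real.exp (256 / a) * (64 / a * eta ^ 2) := by ring
      _ ≤ Real.exp (256 / a) * (Real.exp (64 / a) * Real.exp (-(320 / a))) := by gcongr
      _ = 1 := by
        rw [← Real.exp_add, ← Real.exp_add, Real.exp_eq_one_iff]; ring
  refine (prob_not_expanding_le hG hd (by positivity) hcd _ (by positivity)
    (by positivity) hexp).trans ((exp_neg_mul_le one_pos hN ?_).trans_eq (by rw [div_one]))
  have h1 : 256 / a * (a * (n / d) / 2) = 128 * (n / d : ℝ) := by
    generalize (n / d : ℝ) = N
    field_simp
    ring
  have h2 : c / d * n = c * (n / d : ℝ) := by ring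
  rw [h1, h2]
  nlinarith

lemma prob_four_mul_le_card_le {c : ℝ} (hd : 0 < d) (hn : 0 < n) (hc0 : 0 ≤ c) (hc : c ≤ 2)
    (hcd : c / d ≤ 1) :
    prob (c / d) (fun P : Finset (Fin n) => 4 * (n / d : ℝ) ≤ #P) ≤ 2 / (n / d) := by
  have hN : (0 : ℝ) < n / d := by positivity
  refine (prob_le_card_le (by positivity) hcd _ (Real.log_nonneg one_le_two)).trans
    ((exp_neg_mul_le (y := 1 / 2) (by norm_num) hN ?_).trans_eq (by norm_num))
  rw [Real.exp_log two_pos, Fintype.card_fin]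
  have := Real.log_two_gt_d9
  have h2 : n * (c / d * (2 - 1)) = c * (n / d : ℝ) := by ring
  rw [h2]
  nlinarith

lemma boundary_exponent_le {a N κ : ℝ} (ha0 : 0 < a) (ha : a ≤ 1 / 2 ^ 40) (hN : 0 < N)
    (hκ : 1 / a ^ 6 ≤ κ) :
    2 * N * Real.exp (-(1 / a)) + 1 / a * (4 * N / κ) - 4 * (a ^ 2 / 4096) ^ 2 * N ≤
      -((a ^ 2 / 4096) ^ 2 * N) := by
  have h1 : Real.exp (-(1 / a)) ≤ 120 * a ^ 5 := by
    have := Real.pow_div_factorial_le_exp (1 / a) (by positivity) 5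
    rw [Real.exp_neg, inv_le_comm₀ (Real.exp_pos _) (by positivity)]
    refine le_trans (le_of_eq ?_) this
    norm_num [Nat.factorial]
    ring
  have h2 : 1 / a * (4 * N / κ) ≤ 4 * a ^ 5 * N := by
    calc 1 / a * (4 * N / κ) ≤ 1 / a * (4 * N / (1 / a ^ 6)) := by gcongr
      _ = _ := by field_simp
  have h3 : 244 * a ^ 5 ≤ (a ^ 2 / 4096) ^ 2 := by
    nlinarith [pow_pos ha0 4]
  have h4 : 244 * a ^ 5 * N ≤ (a ^ 2 / 4096) ^ 2 * N := by gcongr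
  have h5 : 2 * N * Real.exp (-(1 / a)) ≤ 2 * N * (120 * a ^ 5) := by gcongr
  have h6 : 0 < (a ^ 2 / 4096) ^ 2 * N := by positivity
  nlinarith

lemma cycle_exponent_le {a eta N κ y : ℝ} (ha0 : 0 < a) (ha : a ≤ 1 / 2 ^ 40)
    (hN0 : 0 < N) (hκ0 : 0 < κ) (hκ : κ ≤ 2 / a ^ 6) (hy : 0 ≤ y) (heta0 : 0 ≤ eta)
    (heta : eta ≤ a ^ 20) (hN : 16 * (κ ^ 3 * y) / a ≤ N) :
    Real.exp 2 * (κ * (y + 8 * eta * N)) - 2 * (a / κ ^ 2 * N) ≤ -(a / κ ^ 2 * N) := by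
  have he : Real.exp 2 ≤ 8 := by
    have := Real.exp_one_lt_d9
    rw [show (2 : ℝ) = 1 + 1 by norm_num, Real.exp_add]
    nlinarith [Real.exp_pos 1]
  have h1 : 16 * (κ * y) ≤ a / κ ^ 2 * N := by
    rw [div_le_iff₀ ha0] at hN
    rw [div_mul_eq_mul_div, le_div_iff₀ (by positivity)]
    linarith
  have h4 : 128 * (κ * eta) ≤ a / κ ^ 2 := by
    rw [le_div_iff₀ (by positivity)]
    calc 128 * (κ * eta) * κ ^ 2 = 128 * κ ^ 3 * eta := by ring
      _ ≤ 128 * (2 / a ^ 6) ^ 3 * a ^ 20 := by gcongr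
      _ = 1024 * a * a := by field_simp; ring
      _ ≤ 1 * a := by
        gcongr
        linarith
      _ = a := one_mul a
  have h5 : 128 * (κ * eta) * N ≤ a / κ ^ 2 * N := by gcongr
  have h6 : 0 ≤ κ * (y + 8 * eta * N) := by positivity
  have h7 := mul_le_mul_of_nonneg_right he h6
  linarith

/-- The quantitative form of the main result. -/
lemma prob_edgesOutside_le {a c eta : ℝ} {K : ℕ} (hG : Pseudorandom G d eta) (hd : 0 < d)
    (hn : 0 < n) (ha0 : 0 < a) (ha : a ≤ 1 / 2 ^ 40) (hc1 : 1 ≤ c) (hc2 : c ≤ 2)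
    (heta0 : 0 ≤ eta) (heta1 : eta ≤ a ^ 20) (heta2 : eta ≤ Real.exp (-(160 / a)))
    (hK1 : 1 / a ^ 6 ≤ K) (hK2 : K ≤ 2 / a ^ 6) (hda : 2 ^ 15 / a ^ 2 ≤ d)
    (hN : 16 * (K ^ 3 * 2 ^ K) / a ≤ n / d) :
    prob (c / d) (fun P => ¬ ((edgesOutside G P : ℝ) ≤
        a * (n / d) + √(3 * (a * (n / d)) * (25 * (n / d))))) ≤
      (23 + 2 / (a ^ 2 / 4096) ^ 2 + K ^ 2 / a) / (n / d) := by
  have hN0 : (0 : ℝ) < n / d := by positivity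
  have ha1 : a ≤ 1 := ha.trans (by norm_num)
  have ha2 : a ^ 2 ≤ 1 := pow_le_one₀ ha0.le ha1
  have hK0 : (0 : ℝ) < K := lt_of_lt_of_le (by positivity) hK1
  have hp0 : 0 < c / d := by positivity
  have hpς : 4 * (c / d) ≤ a ^ 2 / 4096 := by
    rw [← mul_div_assoc, div_le_div_iff₀ (by positivity) (by norm_num)]
    rw [div_le_iff₀ (by positivity)] at hda
    nlinarith
  have hp1 : c / d ≤ 1 := by linarith
  have hpn : c / d * n = c * (n / d : ℝ) := by ring
  have hpn2 : c / d * Fintype.card (Fin n) ≤ 2 * (n / d : ℝ) := by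
    rw [Fintype.card_fin, hpn]
    gcongr
  have hE1 := prob_not_expanding_le_one_div hG hd hn ha0 (by linarith) hc2 hp1 heta0 heta2
  have hE2 := prob_four_mul_le_card_le hd hn (by linarith : 0 ≤ c) hc2 hp1
  have hKς : 1 ≤ K * (a ^ 2 / 4096) := by
    calc (1 : ℝ) ≤ 1 / a ^ 6 * (a ^ 2 / 4096) := by
          rw [← mul_div_assoc, le_div_iff₀ (by norm_num), one_div_mul_eq_div,
            le_div_iff₀ (by positivity)]
          nlinarith [pow_le_pow_left₀ ha0.le ha 4, pow_pos ha0 2]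
      _ ≤ K * (a ^ 2 / 4096) := by gcongr
  have hE3 := (prob_bdry_deviation_le (G := G) (z := 1 / a) hp0 hpς (by positivity)
    (by linarith) hN0.le hpn2 hKς (by positivity)).trans (mul_le_mul_of_nonneg_left
      (exp_neg_mul_le (by positivity) hN0 (boundary_exponent_le ha0 ha hN0 hK1)) two_pos.le)
  have heta3 : eta ≤ 1 / 2 :=
    heta1.trans ((pow_le_of_le_one ha0.le ha1 (by norm_num)).trans (ha.trans (by norm_num)))
  have hE4 := (prob_exists_disjoint_family_le hp0.le hp1 (shortCycles G K)
    (sum_shortCycles_le hG hd heta0 heta3 (by linarith) hc2 K) (a / K ^ 2 * (n / d))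
    two_pos.le).trans (exp_neg_mul_le (by positivity) hN0
      (cycle_exponent_le ha0 ha hN0 hK0 hK2 (by positivity) heta0 heta1 hN))
  have hE5 := prob_sum_degIn_sq_ge_le hG.regular hp0.le hp1
    (by rwa [div_mul_cancel₀ _ (by positivity)]) hN0 hpn2
  refine (prob_mono hp0.le hp1 fun P hbad => ?_).trans
    ((prob_or_le hp0.le hp1 _ _).trans ((add_le_add
      ((prob_or_le hp0.le hp1 _ _).trans (add_le_add hE1 hE2))
      ((prob_or_le hp0.le hp1 _ _).trans (add_le_add hE3
        ((prob_or_le hp0.le hp1 _ _).trans (add_le_add hE4 hE5))))).trans (le_of_eq ?_)))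
  · by_contra hgood
    push Not at hgood
    obtain ⟨⟨h1, h2⟩, h3, h4, h5⟩ := hgood
    refine hbad (ncard_edges_outside_le (p := c / d) (ς := a ^ 2 / 4096)
      (m := a / K ^ 2 * (n / d)) (K := K) hd hn ha0 ha1 h1 h2.le hp0.le ?_ ?_ ?_ h4 ?_ h5.le)
    · rw [hpn]
      nlinarith
    · nlinarith
    · intro R S hR hRS hS hSP hdis
      by_contra! hge
      exact h3 R S hR hRS hS hge hSP hdis
    · rw [mul_right_comm, div_mul_cancel₀ _ (by positivity)]
  · generalize (n / d : ℝ) = N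
    generalize (a ^ 2 / 4096) ^ 2 = x
    rw [one_div_div]
    ring

end Main

section Parameters

lemma rpow_two_div_le_exp {a : ℝ} (ha0 : 0 < a) (ha : a ≤ Real.exp (-80)) :
    a ^ ((2 : ℝ) / a) ≤ Real.exp (-(160 / a)) := by
  rw [Real.rpow_def_of_pos ha0, Real.exp_le_exp]
  have h : Real.log a ≤ -80 := (Real.log_le_iff_le_exp ha0).2 ha
  calc Real.log a * (2 / a) ≤ -80 * (2 / a) := by gcongr
    _ = -(160 / a) := by ring

lemma rpow_two_div_le_pow {a : ℝ} (ha0 : 0 < a) (ha : a ≤ 1 / 10) :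
    a ^ ((2 : ℝ) / a) ≤ a ^ 20 := by
  rw [← Real.rpow_natCast]
  refine Real.rpow_le_rpow_of_exponent_ge ha0 (by linarith) ?_
  rw [le_div_iff₀ ha0]
  push_cast
  linarith

lemma exp_neg_eighty_le : Real.exp (-80) ≤ 1 / 2 ^ 40 := by
  rw [Real.exp_neg, ← one_div]
  refine one_div_le_one_div_of_le (by norm_num) ?_
  calc (2 : ℝ) ^ 40 ≤ Real.exp 1 ^ 40 := by
        gcongr
        linarith [Real.add_one_le_exp (1 : ℝ)]
    _ = Real.exp 40 := by rw [← Real.exp_nat_mul]; norm_num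
    _ ≤ Real.exp 80 := Real.exp_le_exp.2 (by norm_num)

lemma mul_add_sqrt_le {a N : ℝ} (ha0 : 0 ≤ a) (ha : a ≤ 1 / 2 ^ 4) (hN : 0 ≤ N) :
    a * N + √(3 * (a * N) * (25 * N)) ≤ 7 * a ^ ((1 : ℝ) / 4) * N := by
  obtain ⟨r, hr0, hra, hr⟩ : ∃ r : ℝ, 0 ≤ r ∧ r ^ 4 = a ∧ a ^ ((1 : ℝ) / 4) = r :=
    ⟨a ^ ((1 : ℝ) / 4), by positivity, by
      rw [← Real.rpow_natCast, ← Real.rpow_mul ha0]; norm_num, rfl⟩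
  have hr2 : r ≤ 1 / 2 := by
    refine le_of_pow_le_pow_left₀ (n := 4) (by norm_num) (by norm_num) ?_
    rw [hra]
    exact ha.trans_eq (by norm_num)
  have hs : √(3 * (a * N) * (25 * N)) ≤ 9 * r ^ 2 * N := by
    rw [Real.sqrt_le_left (by positivity), ← hra]
    nlinarith [mul_nonneg (pow_nonneg hr0 4) (sq_nonneg N)]
  have h : r ^ 4 + 9 * r ^ 2 ≤ 7 * r := by
    nlinarith [mul_nonneg hr0 hr0, pow_nonneg hr0 3, mul_nonneg hr0 (sub_nonneg.2 hr2),
      mul_nonneg (pow_nonneg hr0 2) (sub_nonneg.2 hr2),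
      mul_nonneg (pow_nonneg hr0 3) (sub_nonneg.2 hr2)]
  rw [hr, ← hra] at *
  nlinarith

variable {n d : ℕ} {G : SimpleGraph (Fin n)}

lemma pseudorandom_of_isNDLGraph [DecidableRel G.Adj] {lam eta : ℝ} (hd : 0 < d)
    (hG : IsNDLGraph n d lam G) (h0 : 0 ≤ eta) (h1 : eta < 1) (hlam : lam / d ≤ eta) :
    Pseudorandom G d eta := by
  have hd' : (0 : ℝ) < d := by exact_mod_cast hd
  obtain rfl : ‹DecidableRel G.Adj› = Classical.decRel G.Adj := Subsingleton.elim _ _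
  let := Classical.decRel G.Adj
  obtain ⟨hreg, i₀, hi₀, hle⟩ := hG
  exact pseudorandom_of_eigenvalues hd G.adjHermitian hreg hi₀ h0 h1
    fun i hi => (hle i hi).trans ((div_le_iff₀ hd').1 hlam)

/-- Pseudorandomness forces the degree to be large. -/
lemma Pseudorandom.one_le_two_mul_sq_mul [DecidableRel G.Adj] {eta : ℝ}
    (hG : Pseudorandom G d eta) (hd : 0 < d) (hn : 2 * d ≤ n) : 1 ≤ 2 * eta ^ 2 * (d : ℝ) := by
  have hd' : (0 : ℝ) < d := by exact_mod_cast hd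
  have hn' : 2 * (d : ℝ) ≤ n := by exact_mod_cast hn
  have h := hG.le_card
  have h1 : (n : ℝ) * d * 1 ≤ n * d * (2 * eta ^ 2 * d) := by
    nlinarith [mul_le_mul_of_nonneg_right hn' hd'.le]
  exact le_of_mul_le_mul_left h1 (mul_pos (by linarith) hd')

lemma two_pow_div_sq_le {a eta x : ℝ} (ha0 : 0 < a) (ha : a ≤ 1 / 2 ^ 40) (heta0 : 0 ≤ eta)
    (heta : eta ≤ a ^ 20) (hx : 0 ≤ x) (h : 1 ≤ 2 * eta ^ 2 * x) : 2 ^ 15 / a ^ 2 ≤ x := by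
  rw [div_le_iff₀ (by positivity)]
  have h1 : eta ≤ a * (1 / 2 ^ 8) := by
    calc eta ≤ a ^ 20 := heta
      _ ≤ a ^ 2 := pow_le_pow_of_le_one ha0.le (ha.trans (by norm_num)) (by norm_num)
      _ = a * a := sq a
      _ ≤ a * (1 / 2 ^ 8) := by
        gcongr
        exact ha.trans (by norm_num)
  have h2 : eta ^ 2 ≤ (a * (1 / 2 ^ 8)) ^ 2 := by gcongr
  have h3 := mul_le_mul_of_nonneg_right h2 hx
  nlinarith

end Parameters

end SitePercolation

open SitePercolation in
/-- There is `ε₀ > 0` such that for every `ε ∈ (0, ε₀)` and `α ∈ (0, ε⁸)`, and every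
`γ > 0`, there are `β > 0` and `n₀` such that for all `n ≥ n₀`, all `d` with
`1 + ε ≤ d ≤ β n`, and every `(n,d,λ)`-graph `G` with `λ/d ≤ α^{2/α}`, with
probability at least `1 - γ` the number of edges of the percolated subgraph lying
in connected components that are neither of largest order nor trees is at most
`7 α^{1/4} n / d`. -/
theorem edges_outside_giant_and_trees :
    ∃ ε₀ > (0 : ℝ), ∀ ε : ℝ, 0 < ε → ε < ε₀ → ∀ α : ℝ, 0 < α → α < ε ^ 8 →
      ∀ γ > (0 : ℝ), ∃ β > (0 : ℝ), ∃ n₀ : ℕ,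
        ∀ n : ℕ, n₀ ≤ n → ∀ d : ℕ, 1 + ε ≤ (d : ℝ) → (d : ℝ) ≤ β * n →
          ∀ (lam : ℝ) (G : SimpleGraph (Fin n)),
            IsNDLGraph n d lam G → lam / d ≤ α ^ ((2 : ℝ) / α) →
              ENNReal.ofReal (1 - γ) ≤
                percolationMeasure (Fin n) ((1 + ε) / d)
                  {ω : Fin n → Bool |
                    ({e ∈ (G.induce (percSet ω)).edgeSet |
                        ∃ v, v ∈ e ∧
                          (∃ C' : (G.induce (percSet ω)).ConnectedComponent,
                            ((G.induce (percSet ω)).connectedComponentMk v).supp.ncard <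
                              C'.supp.ncard) ∧
                          ¬ ((G.induce (percSet ω)).induce
                              ((G.induce (percSet ω)).connectedComponentMk v).supp).IsTree}.ncard
                        : ℝ) ≤ 7 * α ^ ((1 : ℝ) / 4) * n / d} := by
  refine ⟨Real.exp (-10), Real.exp_pos _, fun ε hε0 hε1 α hα0 hα γ hγ => ?_⟩
  have hα1 : α ≤ Real.exp (-80) := by
    calc α ≤ Real.exp (-10) ^ 8 := hα.le.trans (by gcongr)
      _ = Real.exp (-80) := by rw [← Real.exp_nat_mul]; norm_num
  have hα2 : α ≤ 1 / 2 ^ 40 := hα1.trans exp_neg_eighty_le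
  have hε2 : ε ≤ 1 := hε1.le.trans (Real.exp_le_one_iff.2 (by norm_num))
  obtain ⟨K, hK1, hK2⟩ : ∃ K : ℕ, 1 / α ^ 6 ≤ K ∧ (K : ℝ) ≤ 2 / α ^ 6 := by
    refine ⟨⌈1 / α ^ 6⌉₊, Nat.le_ceil _, (Nat.ceil_lt_add_one (by positivity)).le.trans ?_⟩
    have : 1 ≤ 1 / α ^ 6 := by
      rw [one_le_div (by positivity)]
      exact pow_le_one₀ hα0.le (hα2.trans (by norm_num))
    calc 1 / α ^ 6 + 1 ≤ 1 / α ^ 6 + 1 / α ^ 6 := by gcongr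
      _ = 2 / α ^ 6 := by ring
  obtain ⟨N₁, hN₁, hN₁0⟩ : ∃ N₁ : ℝ, 16 * ((K : ℝ) ^ 3 * 2 ^ K) / α = N₁ ∧ 0 ≤ N₁ :=
    ⟨_, rfl, by positivity⟩
  obtain ⟨C, hC, hC0⟩ : ∃ C : ℝ, 23 + 2 / (α ^ 2 / 4096) ^ 2 + (K : ℝ) ^ 2 / α = C ∧ 0 ≤ C :=
    ⟨_, rfl, by positivity⟩
  have hβ : 0 < 2 + N₁ + C / γ := by positivity
  refine ⟨1 / (2 + N₁ + C / γ), by positivity, 0, fun n _ d hd1 hdn lam G hG hlam => ?_⟩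
  classical
  have hd' : (0 : ℝ) < d := by linarith
  have hd : 0 < d := by exact_mod_cast hd'
  have hN : 2 + N₁ + C / γ ≤ n / d := by
    rw [one_div_mul_eq_div, le_div_iff₀ hβ] at hdn
    rwa [le_div_iff₀ hd', mul_comm]
  have hCγ : 0 ≤ C / γ := by positivity
  have hN0 : (0 : ℝ) < n / d := by linarith
  have h2d : 2 * d ≤ n := by
    have : (2 : ℝ) ≤ n / d := by linarith
    rw [le_div_iff₀ hd'] at this
    exact_mod_cast this
  have heta0 : 0 ≤ α ^ ((2 : ℝ) / α) := by positivity
  have heta1 := rpow_two_div_le_pow hα0 (hα2.trans (by norm_num))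
  have heta2 : α ^ ((2 : ℝ) / α) < 1 :=
    heta1.trans_lt (pow_lt_one₀ hα0.le (hα2.trans_lt (by norm_num)) (by norm_num))
  have hP := pseudorandom_of_isNDLGraph hd hG heta0 heta2 hlam
  have hmain := prob_edgesOutside_le hP hd (by lia) hα0 hα2 (c := 1 + ε) (by linarith)
    (by linarith) heta0 heta1 (rpow_two_div_le_exp hα0 hα1) hK1 hK2
    (two_pow_div_sq_le hα0 hα2 heta0 heta1 hd'.le (hP.one_le_two_mul_sq_mul hd h2d))
    (by rw [hN₁]; linarith)
  rw [hC] at hmain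
  have hγ' : C / (n / d) ≤ γ := by
    rw [div_le_iff₀ hN0]
    have : C / γ ≤ n / d := by linarith
    rw [div_le_iff₀ hγ] at this
    linarith
  refine (ENNReal.ofReal_le_ofReal (sub_le_sub_left (hmain.trans hγ') 1)).trans
    (ofReal_one_sub_prob_le (by positivity) ((div_le_one hd').2 hd1) _ _ fun ω hω => ?_)
  rw [not_not] at hω
  have h7 := hω.trans (mul_add_sqrt_le hα0.le (hα2.trans (by norm_num)) hN0.le)
  rw [← mul_div_assoc, edgesOutside, ← percSet_eq] at h7
  exact h7
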